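/- arXiv:2510.26039 — 2 statements merged into one kernel-verified Lean document; each statement's English description precedes it below -/
import Mathlib

section
/- Under the standing hypotheses on q, λ, Φ_q, Φ_{q+λ}, W, f, K_c, K_p listed in the context, suppose ā₁ ≤ ā₂, and let a† := inf{a ∈ ℝ : ∫₀^∞ e^{−Φ_q y} f̃'(y + a) dy ≥ 0}. Then: (i) a† is finite and a† < ā₁; (ii) Γ(a†, b) < 0 for every b > a†; (iii) lim_{b→∞} Γ(a†, b) = −∞; (iv) sup_{b > a†} Γ(a†, b) < 0; and (v) sup_{b > ā₁} Γ(ā₁, b) > 0. -/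
open MeasureTheory Filter Set Real

noncomputable section

/-- Tilted inventory-cost derivative integrand against the scale function:
`ρ_a(b) = ∫_a^b g(y) W(b - y) dy`. -/
def rho (W g : ℝ → ℝ) (a b : ℝ) : ℝ :=
  ∫ y in a..b, g y * W (b - y)

/-- `Γ(a, b)` of the paper (display (Gamma)). -/
def Gam (lam Phiq Kp Kc : ℝ) (W g : ℝ → ℝ) (a b : ℝ) : ℝ :=
  (∫ y in Set.Ioi (0:ℝ), Real.exp (-Phiq * y) * g (y + a)) +
    lam * (∫ y in (0:ℝ)..(b - a), Real.exp (-Phiq * y) * rho W g a (y + a)) +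
    lam / Phiq * Real.exp (-Phiq * (b - a)) * (Kp - Kc)

/-- `Γ₁(a) = Γ(a, a+)`. -/
def Gam1 (lam Phiq Kp Kc : ℝ) (g : ℝ → ℝ) (a : ℝ) : ℝ :=
  (∫ y in Set.Ioi (0:ℝ), Real.exp (-Phiq * y) * g (y + a)) + lam / Phiq * (Kp - Kc)

/-- `Γ₂(a) = lim_{b→∞} Γ(a,b)/Θ(b-a)`. -/
def Gam2 (Phiql : ℝ) (g : ℝ → ℝ) (a : ℝ) : ℝ :=
  ∫ y in Set.Ioi (0:ℝ), Real.exp (-Phiql * y) * g (y + a)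

/-- `Θ(x) = Θ^{(q+λ)}(x, Φ(q))`. -/
def Theta (lam Phiq : ℝ) (W : ℝ → ℝ) (x : ℝ) : ℝ :=
  1 + lam * (∫ y in (0:ℝ)..x, Real.exp (-Phiq * y) * W y)

/-- `γ(a,b) = -ρ_a(b) + K_p - K_c`. -/
def gam (Kp Kc : ℝ) (W g : ℝ → ℝ) (a b : ℝ) : ℝ :=
  -(rho W g a b) + Kp - Kc

/-- `Z(x) = Z^{(q+λ)}(x) = 1 + (q+λ)∫₀^{x ∨ 0} W(y) dy`. -/
def Zfun (q lam : ℝ) (W : ℝ → ℝ) (x : ℝ) : ℝ :=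
  1 + (q + lam) * (∫ y in (0:ℝ)..(max x 0), W y)

/-- Second scale function `Ẑ(x) = Z^{(q+λ)}(x, Φ(q))`. -/
def Zhat (lam Phiq : ℝ) (W : ℝ → ℝ) (x : ℝ) : ℝ :=
  Real.exp (Phiq * x) *
    (1 + lam * (∫ z in (0:ℝ)..(max x 0), Real.exp (-Phiq * z) * W z))

open scoped Topology

/-- The exponentially damped tail integral `∫_a^∞ e^{-φ x} g(x) dx`. -/
def dampedTail (φ : ℝ) (g : ℝ → ℝ) (a : ℝ) : ℝ :=
  ∫ x in Ioi a, exp (-φ * x) * g x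

/-- The Laplace-type transform `∫_0^∞ e^{-φ y} g(y + a) dy`. -/
def shiftedLaplace (φ : ℝ) (g : ℝ → ℝ) (a : ℝ) : ℝ :=
  ∫ y in Ioi (0:ℝ), exp (-φ * y) * g (y + a)

lemma shiftedLaplace_eq_dampedTail (φ : ℝ) (g : ℝ → ℝ) (a : ℝ) :
    shiftedLaplace φ g a = exp (φ * a) * dampedTail φ g a := by
  unfold shiftedLaplace dampedTail
  have h := (measurePreserving_add_right (volume : Measure ℝ) a).setIntegral_preimage_emb
    (measurableEmbedding_addRight a) (fun x => exp (φ * a) * (exp (-φ * x) * g x)) (Ioi a)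
  have hs : (fun x => x + a) ⁻¹' Ioi a = Ioi (0:ℝ) := by
    ext x; simp
  rw [hs] at h
  rw [← integral_const_mul, ← h]
  refine integral_congr_ae (Eventually.of_forall fun y => ?_)
  simp only
  rw [← mul_assoc, ← exp_add]
  congr 2
  ring

lemma rightDeriv_monotone {f f' : ℝ → ℝ} (hf : ConvexOn ℝ univ f)
    (hf' : ∀ x, HasDerivWithinAt f (f' x) (Ici x) x) : Monotone f' := by
  have h : ∀ x, derivWithin f (Ioi x) x = f' x := fun x =>
    ((hf' x).mono Ioi_subset_Ici_self).derivWithin (uniqueDiffWithinAt_Ioi x)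
  intro x y hxy
  have := hf.monotoneOn_rightDeriv (a := x) (b := y)
  simpa [h, hxy] using this

lemma rightDeriv_isBigO_exp {f f' : ℝ → ℝ} (hf : ConvexOn ℝ univ f)
    (hf' : ∀ x, HasDerivWithinAt f (f' x) (Ici x) x)
    (hgrowth : ∃ C M : ℝ, ∃ N : ℕ, 0 < C ∧ 0 < M ∧ ∀ x : ℝ, M < |x| → |f x| ≤ C * |x| ^ N)
    {ε : ℝ} (hε : 0 < ε) : f' =O[atTop] fun x => exp (ε * x) := by
  obtain ⟨C, M, N, hC, hM, hfx⟩ := hgrowth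
  have hmono := rightDeriv_monotone hf hf'
  have hO : (fun x : ℝ => |f' 0| + 2 * C * 2 ^ N * x ^ N) =O[atTop] fun x => exp (ε * x) := by
    refine Asymptotics.IsBigO.add ?_
      ((isLittleO_pow_exp_pos_mul_atTop N hε).isBigO.const_mul_left _)
    simpa using ((isLittleO_pow_exp_pos_mul_atTop 0 hε).isBigO.const_mul_left |f' 0|)
  refine Asymptotics.IsBigO.trans (Asymptotics.IsBigO.of_bound 1 ?_) hO
  filter_upwards [eventually_gt_atTop M, eventually_ge_atTop 1] with x hxM hx1
  have hx0 : (0:ℝ) < x := by linarith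
  have h1 : f' x ≤ f (x + 1) - f x := by
    have := hf.le_slope_of_hasDerivWithinAt_Ioi (mem_univ x) (mem_univ (x + 1)) (by linarith)
      ((hf' x).mono Ioi_subset_Ici_self)
    simpa [slope_def_field] using this
  have h2 : |f x| ≤ C * (2 * x) ^ N := by
    refine (hfx x (by rwa [abs_of_pos hx0])).trans ?_
    rw [abs_of_pos hx0]
    gcongr
    linarith
  have h3 : |f (x + 1)| ≤ C * (2 * x) ^ N := by
    have hp : (0:ℝ) < x + 1 := by linarith
    refine (hfx (x + 1) (by rw [abs_of_pos hp]; linarith)).trans ?_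
    rw [abs_of_pos hp]
    gcongr
    linarith
  have h4 := hmono hx0.le
  have h5 : (0:ℝ) ≤ 2 * C * 2 ^ N * x ^ N := by positivity
  have h6 : C * (2 * x) ^ N = C * 2 ^ N * x ^ N := by rw [mul_pow]; ring
  rw [one_mul, norm_eq_abs, norm_eq_abs, abs_of_nonneg (a := |f' 0| + _) (by positivity)]
  rw [h6] at h2 h3
  rw [abs_le] at h2 h3
  rw [abs_le]
  constructor
  · linarith [neg_abs_le (f' 0)]
  · linarith [abs_nonneg (f' 0)]

lemma integrableOn_exp_mul_of_isBigO {g : ℝ → ℝ} (hg : Monotone g)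
    (hO : ∀ ε > 0, g =O[atTop] fun x => exp (ε * x)) {φ : ℝ} (hφ : 0 < φ) (a : ℝ) :
    IntegrableOn (fun x => exp (-φ * x) * g x) (Ioi a) := by
  have hloc : LocallyIntegrable (fun x => exp (-φ * x) * g x) := by
    exact LocallyIntegrable.continuous_mul (by fun_prop) hg.locallyIntegrable
  refine ((hloc.locallyIntegrableOn (Ici a)).integrableOn_of_isBigO_atTop
    (g := fun x => exp (-(φ / 2) * x)) ?_ ⟨Ioi 0, Ioi_mem_atTop 0,
      exp_neg_integrableOn_Ioi 0 (half_pos hφ)⟩).mono_set Ioi_subset_Ici_self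
  refine ((Asymptotics.isBigO_refl (fun x => exp (-φ * x)) atTop).mul
    (hO (φ / 2) (half_pos hφ))).congr_right fun x => ?_
  rw [← exp_add]
  congr 1
  ring

section Laplace

variable {φ : ℝ} {g : ℝ → ℝ}

lemma dampedTail_eq_add (hint : ∀ a, IntegrableOn (fun x => exp (-φ * x) * g x) (Ioi a))
    (a b : ℝ) :
    dampedTail φ g a = (∫ x in a..b, exp (-φ * x) * g x) + dampedTail φ g b :=
  (intervalIntegral.integral_interval_add_Ioi (hint a) (hint b)).symm

lemma continuous_shiftedLaplace
    (hint : ∀ a, IntegrableOn (fun x => exp (-φ * x) * g x) (Ioi a)) :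
    Continuous (shiftedLaplace φ g) := by
  have h : shiftedLaplace φ g = fun a => exp (φ * a) * dampedTail φ g a :=
    funext fun a => shiftedLaplace_eq_dampedTail φ g a
  rw [h]
  refine (by fun_prop : Continuous fun a => exp (φ * a)).mul ?_
  rw [continuous_iff_continuousAt]
  intro a
  exact (hint (a - 1)).continuousOn_Ici_primitive_Ioi.continuousAt
    (Ici_mem_nhds (by linarith))

lemma integrableOn_shift (hint : ∀ a, IntegrableOn (fun x => exp (-φ * x) * g x) (Ioi a))
    (a : ℝ) : IntegrableOn (fun y => exp (-φ * y) * g (y + a)) (Ioi 0) := by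
  have h := ((measurePreserving_add_right (volume : Measure ℝ) a).integrableOn_comp_preimage
    (measurableEmbedding_addRight a)).2 ((hint a).const_mul (exp (φ * a)))
  have hs : (fun x => x + a) ⁻¹' Ioi a = Ioi (0:ℝ) := by
    ext x; simp
  rw [hs] at h
  refine h.congr_fun (fun y _ => ?_) measurableSet_Ioi
  simp only [Function.comp]
  rw [← mul_assoc, ← exp_add]
  congr 2
  ring

lemma monotone_shiftedLaplace (hg : Monotone g)
    (hint : ∀ a, IntegrableOn (fun x => exp (-φ * x) * g x) (Ioi a)) :
    Monotone (shiftedLaplace φ g) := by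
  intro a b hab
  refine setIntegral_mono (integrableOn_shift hint a) (integrableOn_shift hint b) fun y => ?_
  exact mul_le_mul_of_nonneg_left (hg (by linarith)) (exp_pos _).le

lemma div_le_shiftedLaplace (hφ : 0 < φ) (hg : Monotone g)
    (hint : ∀ a, IntegrableOn (fun x => exp (-φ * x) * g x) (Ioi a)) (a : ℝ) :
    g a / φ ≤ shiftedLaplace φ g a := by
  have h : ∫ y in Ioi (0:ℝ), exp (-φ * y) * g a = g a / φ := by
    rw [integral_mul_const, integral_exp_mul_Ioi (by linarith)]
    simp [div_eq_inv_mul]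
  rw [← h]
  refine setIntegral_mono_on ((exp_neg_integrableOn_Ioi 0 hφ).mul_const _)
    (integrableOn_shift hint a) measurableSet_Ioi fun y hy => ?_
  exact mul_le_mul_of_nonneg_left (hg (by linarith [mem_Ioi.1 hy])) (exp_pos _).le

lemma exists_shiftedLaplace_neg (hφ : 0 < φ) (hg : Monotone g)
    (hint : ∀ a, IntegrableOn (fun x => exp (-φ * x) * g x) (Ioi a)) {x₁ : ℝ} (hx₁ : g x₁ < 0) :
    ∃ a, shiftedLaplace φ g a < 0 := by
  set k := exp (-φ * x₁) * g x₁ with hk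
  have hk0 : k < 0 := mul_neg_of_pos_of_neg (exp_pos _) hx₁
  have hlim : Tendsto (fun t : ℝ => dampedTail φ g x₁ + t * k) atTop atBot :=
    tendsto_atBot_add_const_left _ _ (tendsto_id.atTop_mul_const_of_neg hk0)
  obtain ⟨t, ht, ht0⟩ := ((hlim.eventually_lt_atBot 0).and (eventually_ge_atTop 0)).exists
  refine ⟨x₁ - t, ?_⟩
  rw [shiftedLaplace_eq_dampedTail]
  refine mul_neg_of_pos_of_neg (exp_pos _) (lt_of_le_of_lt ?_ ht)
  rw [dampedTail_eq_add hint (x₁ - t) x₁, add_comm]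
  have hle : x₁ - t ≤ x₁ := by linarith
  have h1 : ∫ x in (x₁ - t)..x₁, exp (-φ * x) * g x ≤ ∫ x in (x₁ - t)..x₁, k := by
    refine intervalIntegral.integral_mono_on hle ?_ intervalIntegrable_const fun x hx => ?_
    · exact (intervalIntegrable_iff_integrableOn_Ioc_of_le hle).2
        ((hint _).mono_set Ioc_subset_Ioi_self)
    · have h2 : exp (-φ * x₁) ≤ exp (-φ * x) := exp_le_exp.2 (by nlinarith [hx.2])
      have h3 : g x ≤ g x₁ := hg hx.2
      calc exp (-φ * x) * g x ≤ exp (-φ * x) * g x₁ :=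
            mul_le_mul_of_nonneg_left h3 (exp_pos _).le
        _ ≤ k := mul_le_mul_of_nonpos_right h2 hx₁.le
  simp only [intervalIntegral.integral_const, smul_eq_mul] at h1
  linarith

end Laplace

lemma Monotone.bddBelow_superlevel {H : ℝ → ℝ} (hH : Monotone H) {c a₀ : ℝ} (h : H a₀ < c) :
    BddBelow {a | c ≤ H a} := by
  refine ⟨a₀, fun a ha => ?_⟩
  by_contra! hlt
  exact absurd (hH hlt.le) (not_le.2 (h.trans_le ha))

lemma Continuous.eq_sInf_superlevel {H : ℝ → ℝ} (hH : Continuous H) {c : ℝ}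
    (hne : {a | c ≤ H a}.Nonempty) (hbdd : BddBelow {a | c ≤ H a}) :
    H (sInf {a | c ≤ H a}) = c := by
  have hcl : IsClosed {a | c ≤ H a} := isClosed_le continuous_const hH
  refine le_antisymm ?_ (hcl.csInf_mem hne hbdd)
  refine le_of_tendsto (hH.continuousAt.mono_left nhdsWithin_le_nhds :
    Tendsto H (𝓝[<] sInf {a | c ≤ H a}) _) ?_
  filter_upwards [self_mem_nhdsWithin] with a ha
  exact (not_le.1 fun h => notMem_of_lt_csInf ha hbdd h).le

lemma intervalIntegrable_mul_comp_sub {W g : ℝ → ℝ} (hW : Monotone W) (hg : Monotone g)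
    (a t b : ℝ) : IntervalIntegrable (fun y => g y * W (b - y)) volume a t := by
  have hanti : Antitone fun y => W (b - y) := fun x y hxy => hW (by linarith)
  rw [intervalIntegrable_iff]
  refine Integrable.mul_bdd (c := max |W (b - max a t)| |W (b - min a t)|)
    (intervalIntegrable_iff.1 hg.intervalIntegrable) hanti.measurable.aestronglyMeasurable ?_
  filter_upwards [ae_restrict_mem measurableSet_uIoc] with y hy
  exact abs_le_max_abs_abs (hanti hy.2) (hanti hy.1.le)

lemma continuousOn_rho {W g : ℝ → ℝ} (hW : Monotone W) (hW0 : ∀ x < 0, W x = 0)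
    (hcont : ∀ x ≠ 0, ContinuousAt W x) (hg : Monotone g) (a : ℝ) :
    ContinuousOn (rho W g a) (Ici a) := by
  intro b₀ hb₀
  have hab₀ : a ≤ b₀ := hb₀
  have hnn : ∀ x, 0 ≤ W x := fun x => by
    rw [← hW0 (min x 0 - 1) (by linarith [min_le_right x 0])]
    exact hW (by linarith [min_le_left x 0])
  have hc : ContinuousAt (fun b => ∫ y in a..(b₀ + 1), g y * W (b - y)) b₀ := by
    refine intervalIntegral.continuousAt_of_dominated_interval
      (bound := fun y => |g y| * W (b₀ + 1 - a)) ?_ ?_ ?_ ?_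
    · refine Eventually.of_forall fun b => ?_
      exact (intervalIntegrable_iff.1
        (intervalIntegrable_mul_comp_sub hW hg a (b₀ + 1) b)).aestronglyMeasurable
    · filter_upwards [Iio_mem_nhds (lt_add_one b₀)] with b hb
      refine Eventually.of_forall fun y hy => ?_
      rw [uIoc_of_le (by linarith)] at hy
      rw [norm_mul, norm_eq_abs, norm_eq_abs, abs_of_nonneg (hnn _)]
      exact mul_le_mul_of_nonneg_left (hW (by linarith [hy.1, mem_Iio.1 hb])) (abs_nonneg _)
    · exact hg.intervalIntegrable.abs.mul_const _
    · have hne : ∀ᵐ y ∂(volume : Measure ℝ), y ≠ b₀ := by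
        simp [ae_iff]
      filter_upwards [hne] with y hy _
      refine continuousAt_const.mul ?_
      exact ContinuousAt.comp (f := fun b => b - y) (hcont _ (sub_ne_zero.2 hy.symm)) (by fun_prop)
  have heq : ∀ b < b₀ + 1, rho W g a b = ∫ y in a..(b₀ + 1), g y * W (b - y) := by
    intro b hb
    unfold rho
    rw [← intervalIntegral.integral_add_adjacent_intervals
      (intervalIntegrable_mul_comp_sub hW hg a b b)
      (intervalIntegrable_mul_comp_sub hW hg b (b₀ + 1) b)]
    have h0 : ∫ y in b..(b₀ + 1), g y * W (b - y) = 0 := by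
      rw [intervalIntegral.integral_of_le hb.le]
      refine setIntegral_eq_zero_of_forall_eq_zero fun y hy => ?_
      rw [hW0 _ (by linarith [hy.1]), mul_zero]
    rw [h0, add_zero]
  refine (hc.congr ?_).continuousWithinAt
  filter_upwards [Iio_mem_nhds (lt_add_one b₀)] with b hb
  exact (heq b hb).symm

/-- Normalising by `W (b - c)`, the scale function lies above the exponential to the left of `c`
and below it to the right. -/
lemma rho_le_mul_dampedTail {Φ : ℝ} {W g : ℝ → ℝ} {a b c : ℝ}
    (hW : Monotone W) (hWpos : ∀ x > 0, 0 < W x)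
    (hratio : ∀ a y b : ℝ, a < y → y < b → W (b - y) ≤ W (b - a) * exp (-Φ * (y - a)))
    (hg : Monotone g) (hneg : ∀ x < c, g x ≤ 0) (hpos : ∀ x > c, 0 ≤ g x)
    (hint : ∀ a, IntegrableOn (fun x => exp (-Φ * x) * g x) (Ioi a)) (hac : a < c) (hcb : c < b) :
    rho W g a b ≤ W (b - c) * exp (Φ * c) * dampedTail Φ g a := by
  have hab : a ≤ b := (hac.trans hcb).le
  have hWc := hWpos (b - c) (by linarith)
  have htail : 0 ≤ dampedTail Φ g b :=
    setIntegral_nonneg measurableSet_Ioi fun x hx =>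
      mul_nonneg (exp_pos _).le (hpos x (hcb.trans hx))
  have hII : IntervalIntegrable (fun x => exp (-Φ * x) * g x) volume a b :=
    (intervalIntegrable_iff_integrableOn_Ioc_of_le hab).2
      ((hint _).mono_set Ioc_subset_Ioi_self)
  have hprod : IntervalIntegrable (fun y => g y * W (b - y)) volume a b :=
    intervalIntegrable_mul_comp_sub hW hg a b b
  have hle : rho W g a b ≤ ∫ x in a..b, W (b - c) * exp (Φ * c) * (exp (-Φ * x) * g x) := by
    refine intervalIntegral.integral_mono_on_of_le_Ioo hab hprod (hII.const_mul _) fun y hy => ?_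
    have he : W (b - c) * exp (Φ * c) * (exp (-Φ * y) * g y)
        = g y * (W (b - c) * exp (-Φ * (y - c))) := by
      have : exp (-Φ * (y - c)) = exp (Φ * c) * exp (-Φ * y) := by
        rw [← exp_add]; congr 1; ring
      rw [this]; ring
    rw [he]
    rcases lt_trichotomy y c with hyc | rfl | hyc
    · refine mul_le_mul_of_nonpos_left ?_ (hneg y hyc)
      have h := hratio y c b hyc hcb
      have h2 : exp (-Φ * (c - y)) * exp (-Φ * (y - c)) = 1 := by
        rw [← exp_add]; simp; ring
      calc W (b - c) * exp (-Φ * (y - c))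
          ≤ W (b - y) * exp (-Φ * (c - y)) * exp (-Φ * (y - c)) :=
            mul_le_mul_of_nonneg_right h (exp_pos _).le
        _ = W (b - y) := by rw [mul_assoc, h2, mul_one]
    · simp
    · exact mul_le_mul_of_nonneg_left (hratio c y b hyc hy.2) (hpos y hyc)
  rw [intervalIntegral.integral_const_mul] at hle
  rw [dampedTail_eq_add hint a b, mul_add]
  have : 0 ≤ W (b - c) * exp (Φ * c) * dampedTail Φ g b := by positivity
  linarith

lemma rho_nonpos {Φ : ℝ} {W g : ℝ → ℝ} {a b c : ℝ}
    (hW : Monotone W) (hWnn : ∀ x, 0 ≤ W x) (hWpos : ∀ x > 0, 0 < W x)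
    (hratio : ∀ a y b : ℝ, a < y → y < b → W (b - y) ≤ W (b - a) * exp (-Φ * (y - a)))
    (hg : Monotone g) (hneg : ∀ x < c, g x ≤ 0) (hpos : ∀ x > c, 0 ≤ g x)
    (hint : ∀ a, IntegrableOn (fun x => exp (-Φ * x) * g x) (Ioi a)) (hac : a < c)
    (htail : dampedTail Φ g a ≤ 0) (hab : a ≤ b) :
    rho W g a b ≤ 0 := by
  rcases le_or_gt b c with hbc | hcb
  · have h := intervalIntegral.integral_mono_on_of_le_Ioo hab
      (intervalIntegrable_mul_comp_sub hW hg a b b)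
      (intervalIntegrable_const (c := (0:ℝ)) (μ := volume)) fun y hy =>
        mul_nonpos_of_nonpos_of_nonneg (hneg y (hy.2.trans_le hbc)) (hWnn _)
    simpa [rho] using h
  · exact (rho_le_mul_dampedTail hW hWpos hratio hg hneg hpos hint hac hcb).trans
      (mul_nonpos_of_nonneg_of_nonpos (mul_nonneg (hWnn _) (exp_pos _).le) htail)

lemma intervalIntegrable_exp_mul_shift {r : ℝ → ℝ} {a : ℝ} (hr : ContinuousOn r (Ici a))
    (φ : ℝ) {s t : ℝ} (hs : 0 ≤ s) (ht : 0 ≤ t) :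
    IntervalIntegrable (fun y => exp (-φ * y) * r (y + a)) volume s t := by
  refine ContinuousOn.intervalIntegrable ?_
  refine ContinuousOn.mul (by fun_prop) (hr.comp (by fun_prop) fun y hy => ?_)
  have : 0 ≤ y := (le_min hs ht).trans hy.1
  simpa using this

lemma integral_exp_neg_mul {φ : ℝ} (hφ : φ ≠ 0) (t : ℝ) :
    ∫ y in (0:ℝ)..t, exp (-φ * y) = (1 - exp (-φ * t)) / φ := by
  rw [intervalIntegral.integral_comp_mul_left (fun x => exp x) (neg_ne_zero.2 hφ), integral_exp]
  simp
  field_simp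
  ring

/-- A function eventually bounded above by a negative constant has integrals tending to `-∞`. -/
lemma tendsto_integral_atBot {u : ℝ → ℝ} {m : ℝ} (hm : m < 0)
    (hu : ∀ s t, 0 ≤ s → 0 ≤ t → IntervalIntegrable u volume s t)
    (hle : ∀ᶠ y in atTop, u y ≤ m) :
    Tendsto (fun t => ∫ y in (0:ℝ)..t, u y) atTop atBot := by
  obtain ⟨Y, hY0, hY⟩ := ((eventually_ge_atTop (0:ℝ)).and (eventually_forall_ge_atTop.2 hle)).exists
  have hlim : Tendsto (fun t => (∫ y in (0:ℝ)..Y, u y) + (t - Y) * m) atTop atBot :=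
    tendsto_atBot_add_const_left _ _
      ((tendsto_atTop_add_const_right _ (-Y) tendsto_id).atTop_mul_const_of_neg hm)
  refine tendsto_atBot_mono' _ ?_ hlim
  filter_upwards [eventually_ge_atTop Y] with t ht
  have ht0 : 0 ≤ t := hY0.trans ht
  rw [← intervalIntegral.integral_add_adjacent_intervals (hu 0 Y le_rfl hY0) (hu Y t hY0 ht0)]
  have h := intervalIntegral.integral_mono_on ht (hu Y t hY0 ht0)
    (intervalIntegrable_const (c := m) (μ := volume)) fun y hy => hY y hy.1
  simp only [intervalIntegral.integral_const, smul_eq_mul] at h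
  linarith

/-- Claims of Section 5.1 of the paper (existence in the case ā₁ ≤ ā₂). -/
theorem existence_case_one
    (q lam Phiq Phiql : ℝ) (hq : 0 < q) (hlam : 0 < lam)
    (hPhiq : 0 < Phiq) (hPhi : Phiq < Phiql)
    (W : ℝ → ℝ)
    (hW0 : ∀ x < (0:ℝ), W x = 0)
    (hWnn : ∀ x ≥ (0:ℝ), 0 ≤ W x)
    (hWcont : ContinuousOn W (Set.Ici 0))
    (hWmono : StrictMonoOn W (Set.Ici 0))
    (hWC1 : ContDiffOn ℝ 1 W (Set.Ioi 0))
    (hWratio_mono : ∀ a y : ℝ, a < y →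
      MonotoneOn (fun b => W (b - y) / W (b - a)) (Set.Ioi y))
    (hWratio_lim : ∀ a y : ℝ, a < y →
      Filter.Tendsto (fun b => W (b - y) / W (b - a)) Filter.atTop
        (nhds (Real.exp (-Phiql * (y - a)))))
    (hWasymp : ∃ L : ℝ, 0 < L ∧
      Filter.Tendsto (fun x => Real.exp (-Phiql * x) * W x) Filter.atTop (nhds L))
    (f f' : ℝ → ℝ)
    (hf_conv : ConvexOn ℝ Set.univ f)
    (hf_deriv : ∀ x : ℝ, HasDerivWithinAt f (f' x) (Set.Ici x) x)
    (hf_pw : ∃ E : Set ℝ, E.Countable ∧ ∀ x ∉ E, ContinuousAt f' x)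
    (hf_growth : ∃ C M : ℝ, ∃ N : ℕ, 0 < C ∧ 0 < M ∧
      ∀ x : ℝ, M < |x| → |f x| ≤ C * |x| ^ N)
    (Kc Kp : ℝ) (hK : Kp < Kc)
    (g : ℝ → ℝ) (hg : ∀ x : ℝ, g x = f' x + q * Kc + lam * (Kc - Kp))
    (habar_ne : {a : ℝ | 0 ≤ g a}.Nonempty)
    (habar_bdd : BddBelow {a : ℝ | 0 ≤ g a})
    (habb_ne : {a : ℝ | 0 < f' a + q * Kp}.Nonempty)
    (habb_bdd : BddBelow {a : ℝ | 0 < f' a + q * Kp})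
    (a1 a2 : ℝ)
    (ha1 : a1 = sInf {a : ℝ | 0 ≤ Gam1 lam Phiq Kp Kc g a})
    (ha2 : a2 = sInf {a : ℝ | 0 ≤ Gam2 Phiql g a})
    (ha12 : a1 ≤ a2)
    (adag : ℝ)
    (hadag : adag = sInf {a : ℝ |
      0 ≤ ∫ y in Set.Ioi (0:ℝ), Real.exp (-Phiq * y) * g (y + a)}) :
    ({a : ℝ | 0 ≤ ∫ y in Set.Ioi (0:ℝ), Real.exp (-Phiq * y) * g (y + a)}.Nonempty ∧
      BddBelow {a : ℝ | 0 ≤ ∫ y in Set.Ioi (0:ℝ), Real.exp (-Phiq * y) * g (y + a)} ∧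
      adag < a1) ∧
    (∀ b : ℝ, adag < b → Gam lam Phiq Kp Kc W g adag b < 0) ∧
    Filter.Tendsto (fun b => Gam lam Phiq Kp Kc W g adag b) Filter.atTop Filter.atBot ∧
    sSup ((fun b => Gam lam Phiq Kp Kc W g adag b) '' Set.Ioi adag) < 0 ∧
    0 < sSup ((fun b => Gam lam Phiq Kp Kc W g a1 b) '' Set.Ioi a1) := by
  obtain ⟨L, hL, hWL⟩ := hWasymp
  have hWnn' : ∀ x, 0 ≤ W x := fun x => by
    rcases lt_or_ge x 0 with h | h
    · exact (hW0 x h).ge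
    · exact hWnn x h
  have hW : Monotone W := fun x y hxy => by
    rcases lt_or_ge x 0 with h | h
    · rw [hW0 x h]; exact hWnn' y
    · exact hWmono.monotoneOn h (h.trans hxy) hxy
  have hWpos : ∀ x > 0, 0 < W x := fun x hx =>
    (hWnn 0 le_rfl).trans_lt (hWmono self_mem_Ici hx.le hx)
  have hWc : ∀ x ≠ 0, ContinuousAt W x := fun x hx => by
    rcases lt_or_gt_of_ne hx with h | h
    · refine continuousAt_const.congr (f := fun _ => (0:ℝ)) ?_
      filter_upwards [Iio_mem_nhds h] with y hy
      exact (hW0 y hy).symm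
    · exact hWcont.continuousAt (Ici_mem_nhds h)
  have hratio : ∀ a y b : ℝ, a < y → y < b →
      W (b - y) ≤ W (b - a) * exp (-Phiql * (y - a)) := fun a y b hay hyb => by
    have h : W (b - y) / W (b - a) ≤ exp (-Phiql * (y - a)) := by
      refine ge_of_tendsto (hWratio_lim a y hay) ?_
      filter_upwards [eventually_ge_atTop b] with t ht
      exact hWratio_mono a y hay hyb (hyb.trans_le ht) ht
    rwa [div_le_iff₀' (hWpos _ (by linarith))] at h
  have hf'mono := rightDeriv_monotone hf_conv hf_deriv
  have hgmono : Monotone g := fun x y hxy => by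
    rw [hg, hg]; linarith [hf'mono hxy]
  have hgO : ∀ ε > 0, g =O[atTop] fun x => exp (ε * x) := fun ε hε => by
    have hgeq : g = fun x => f' x + (q * Kc + lam * (Kc - Kp)) := by
      ext x; rw [hg]; ring
    rw [hgeq]
    refine (rightDeriv_isBigO_exp hf_conv hf_deriv hf_growth hε).add ?_
    simpa using ((isLittleO_pow_exp_pos_mul_atTop 0 hε).isBigO.const_mul_left
      (q * Kc + lam * (Kc - Kp)))
  have hPhiql : 0 < Phiql := hPhiq.trans hPhi
  have hint1 := integrableOn_exp_mul_of_isBigO hgmono hgO hPhiq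
  have hint2 := integrableOn_exp_mul_of_isBigO hgmono hgO hPhiql
  obtain ⟨x₀, hx₀⟩ := habb_ne
  have hKd : 0 < Kc - Kp := by linarith
  have hx₀g : (q + lam) * (Kc - Kp) < g x₀ := by
    have : 0 < f' x₀ + q * Kp := hx₀
    rw [hg]; linarith
  obtain ⟨x₁, hx₁⟩ : ∃ x₁, g x₁ < 0 := by
    obtain ⟨m, hm⟩ := habar_bdd
    refine ⟨m - 1, not_le.1 fun h => ?_⟩
    linarith [hm (show m - 1 ∈ {a | 0 ≤ g a} from h)]
  have hqlK : 0 < (q + lam) * (Kc - Kp) := by positivity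
  have hlamK : lam * (Kc - Kp) < (q + lam) * (Kc - Kp) := by nlinarith
  set c := sInf {a : ℝ | 0 ≤ g a} with hc
  have hneg : ∀ x < c, g x ≤ 0 := fun x hx =>
    (not_le.1 fun h => notMem_of_lt_csInf hx habar_bdd h).le
  have hpos : ∀ x > c, 0 ≤ g x := fun x hx => by
    obtain ⟨y, hy, hyx⟩ := exists_lt_of_csInf_lt habar_ne hx
    exact le_trans hy (hgmono hyx.le)
  set d := lam / Phiq * (Kc - Kp) with hd
  have hd0 : 0 < d := by positivity
  have hmono1 := monotone_shiftedLaplace hgmono hint1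
  have hmono2 := monotone_shiftedLaplace hgmono hint2
  obtain ⟨z₁, hz₁⟩ := exists_shiftedLaplace_neg hPhiq hgmono hint1 hx₁
  obtain ⟨z₂, hz₂⟩ := exists_shiftedLaplace_neg hPhiql hgmono hint2 hx₁
  have hx₀L : d ≤ shiftedLaplace Phiq g x₀ := by
    refine le_trans ?_ (div_le_shiftedLaplace hPhiq hgmono hint1 x₀)
    rw [hd, div_mul_eq_mul_div]
    gcongr
    linarith
  have hx₀L2 : 0 < shiftedLaplace Phiql g x₀ :=
    (div_pos (by linarith) hPhiql).trans_le (div_le_shiftedLaplace hPhiql hgmono hint2 x₀)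
  have hne0 : {a | 0 ≤ shiftedLaplace Phiq g a}.Nonempty := ⟨x₀, hd0.le.trans hx₀L⟩
  have hbdd0 : BddBelow {a | 0 ≤ shiftedLaplace Phiq g a} := hmono1.bddBelow_superlevel hz₁
  have hbdd1 : BddBelow {a | d ≤ shiftedLaplace Phiq g a} :=
    hmono1.bddBelow_superlevel (hz₁.trans hd0)
  have hbdd2 : BddBelow {a | 0 ≤ shiftedLaplace Phiql g a} := hmono2.bddBelow_superlevel hz₂
  have ha1' : a1 = sInf {a | d ≤ shiftedLaplace Phiq g a} := by
    rw [ha1]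
    congr 1
    ext a
    have : Gam1 lam Phiq Kp Kc g a = shiftedLaplace Phiq g a - d := by
      rw [hd]; simp only [Gam1, shiftedLaplace]; ring
    simp [this]
  have hLdag : shiftedLaplace Phiq g adag = 0 := by
    rw [hadag]
    exact (continuous_shiftedLaplace hint1).eq_sInf_superlevel hne0 hbdd0
  have hL1 : shiftedLaplace Phiq g a1 = d := by
    rw [ha1']
    exact (continuous_shiftedLaplace hint1).eq_sInf_superlevel ⟨x₀, hx₀L⟩ hbdd1
  have hL2 : shiftedLaplace Phiql g a2 = 0 := by
    rw [ha2]
    exact (continuous_shiftedLaplace hint2).eq_sInf_superlevel ⟨x₀, hx₀L2.le⟩ hbdd2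
  have hdag1 : adag < a1 := hmono1.reflect_lt (by rw [hLdag, hL1]; exact hd0)
  have hLdag2 : shiftedLaplace Phiql g adag < 0 :=
    not_le.1 fun h => notMem_of_lt_csInf (ha2 ▸ hdag1.trans_le ha12) hbdd2 h
  have hL12 : shiftedLaplace Phiql g a1 ≤ 0 := hL2 ▸ hmono2 ha12
  have ha1c : a1 < c := by
    by_contra! hca
    have h1 : 0 ≤ dampedTail Phiql g a1 - dampedTail Phiql g (max a1 x₀) := by
      rw [dampedTail_eq_add hint2 a1 (max a1 x₀), add_sub_cancel_right]
      rw [intervalIntegral.integral_of_le (le_max_left _ _)]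
      exact setIntegral_nonneg measurableSet_Ioc fun x hx =>
        mul_nonneg (exp_pos _).le (hpos x (hca.trans_lt hx.1))
    have h2 : 0 < shiftedLaplace Phiql g (max a1 x₀) :=
      hx₀L2.trans_le (hmono2 (le_max_right _ _))
    rw [shiftedLaplace_eq_dampedTail] at h2 hL12
    have h3 := pos_of_mul_pos_right h2 (exp_pos _).le
    have h4 := nonpos_of_mul_nonpos_right hL12 (exp_pos _)
    linarith
  have hrho : ∀ a ≤ a1, ContinuousOn (rho W g a) (Ici a) ∧ ∀ b ≥ a, rho W g a b ≤ 0 := by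
    intro a ha
    refine ⟨continuousOn_rho hW hW0 hWc hgmono a, fun b hb => ?_⟩
    refine rho_nonpos hW hWnn' hWpos hratio hgmono hneg hpos hint2 (ha.trans_lt ha1c) ?_ hb
    have h := (hmono2 ha).trans hL12
    rw [shiftedLaplace_eq_dampedTail] at h
    exact nonpos_of_mul_nonpos_right h (exp_pos _)
  have hIle : ∀ a ≤ a1, ∀ t ≥ 0,
      ∫ y in (0:ℝ)..t, exp (-Phiq * y) * rho W g a (y + a) ≤ 0 := by
    intro a ha t ht
    have h := intervalIntegral.integral_mono_on ht
      (intervalIntegrable_exp_mul_shift (hrho a ha).1 Phiq le_rfl ht)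
      (intervalIntegrable_const (c := (0:ℝ)) (μ := volume)) fun y hy =>
        mul_nonpos_of_nonneg_of_nonpos (exp_pos _).le ((hrho a ha).2 _ (by linarith [hy.1]))
    simpa using h
  have hGam : ∀ a b, Gam lam Phiq Kp Kc W g a b = shiftedLaplace Phiq g a +
      lam * (∫ y in (0:ℝ)..(b - a), exp (-Phiq * y) * rho W g a (y + a)) -
      d * exp (-Phiq * (b - a)) := fun a b => by
    rw [hd]; simp only [Gam, shiftedLaplace]; ring
  have hGle : ∀ a ≤ a1, ∀ b ≥ a, Gam lam Phiq Kp Kc W g a b ≤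
      shiftedLaplace Phiq g a - d * exp (-Phiq * (b - a)) := fun a ha b hb => by
    rw [hGam]
    have := mul_nonpos_of_nonneg_of_nonpos hlam.le (hIle a ha (b - a) (by linarith))
    linarith
  have hGdag : ∀ b ≥ adag, Gam lam Phiq Kp Kc W g adag b ≤ -(d * exp (-Phiq * (b - adag))) :=
    fun b hb => by simpa [hLdag] using hGle adag hdag1.le b hb
  have hlim : Tendsto (fun b => Gam lam Phiq Kp Kc W g adag b) atTop atBot := by
    have hadagc : adag < c := hdag1.trans ha1c
    have htail : dampedTail Phiql g adag < 0 := by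
      rw [shiftedLaplace_eq_dampedTail] at hLdag2
      exact neg_of_mul_neg_right hLdag2 (exp_pos _).le
    set k := L / 2 * exp (Phiq * (adag - c)) * (exp (Phiql * c) * dampedTail Phiql g adag)
    have hk : k < 0 := mul_neg_of_pos_of_neg (by positivity)
      (mul_neg_of_pos_of_neg (exp_pos _) htail)
    have hev : ∀ᶠ y in atTop, exp (-Phiq * y) * rho W g adag (y + adag) ≤ k := by
      have hWev : ∀ᶠ x in atTop, L / 2 < exp (-Phiql * x) * W x :=
        hWL.eventually_const_lt (half_lt_self hL)
      have hsh : Tendsto (fun y => y + (adag - c)) atTop atTop :=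
        tendsto_atTop_add_const_right _ _ tendsto_id
      filter_upwards [hsh.eventually hWev, hsh.eventually (eventually_gt_atTop 0)] with y h1 h2
      have h3 := rho_le_mul_dampedTail hW hWpos hratio hgmono hneg hpos hint2 hadagc
        (b := y + adag) (by linarith)
      rw [show y + adag - c = y + (adag - c) by ring] at h3
      set x := y + (adag - c)
      have h4 : L / 2 * exp (Phiq * (adag - c)) ≤ exp (-Phiq * y) * W x := by
        have h5 : exp (-Phiql * x) * W x ≤ exp (-Phiq * x) * W x :=
          mul_le_mul_of_nonneg_right (exp_le_exp.2 (by nlinarith)) (hWnn' _)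
        have h6 : exp (-Phiq * x) * exp (Phiq * (adag - c)) = exp (-Phiq * y) := by
          rw [← exp_add]; congr 1; simp only [x]; ring
        calc L / 2 * exp (Phiq * (adag - c))
            ≤ exp (-Phiq * x) * W x * exp (Phiq * (adag - c)) :=
              mul_le_mul_of_nonneg_right (h1.le.trans h5) (exp_pos _).le
          _ = exp (-Phiq * y) * W x := by rw [← h6]; ring
      calc exp (-Phiq * y) * rho W g adag (y + adag)
          ≤ exp (-Phiq * y) * (W x * exp (Phiql * c) * dampedTail Phiql g adag) :=
            mul_le_mul_of_nonneg_left h3 (exp_pos _).le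
        _ = exp (-Phiq * y) * W x * (exp (Phiql * c) * dampedTail Phiql g adag) := by ring
        _ ≤ k := mul_le_mul_of_nonpos_right h4
            (mul_neg_of_pos_of_neg (exp_pos _) htail).le
    have hI := tendsto_integral_atBot hk (fun s t hs ht =>
      intervalIntegrable_exp_mul_shift (hrho adag hdag1.le).1 Phiq hs ht) hev
    have hI' := (hI.comp (tendsto_atTop_add_const_right _ (-adag) tendsto_id)).const_mul_atBot hlam
    refine tendsto_atBot_mono (fun b => ?_) hI'
    rw [hGam, hLdag]
    have : 0 < d * exp (-Phiq * (b - adag)) := by positivity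
    simp only [Function.comp, id, ← sub_eq_add_neg]
    linarith
  refine ⟨⟨hne0, hbdd0, hdag1⟩, fun b hb => ?_, hlim, ?_, ?_⟩
  · exact (hGdag b hb.le).trans_lt (neg_lt_zero.2 (by positivity))
  · obtain ⟨B, hB⟩ := (hlim.eventually_le_atBot (-1)).exists_forall_of_atTop
    refine lt_of_le_of_lt (b := max (-1) (-(d * exp (-Phiq * (B - adag))))) ?_
      (max_lt (by norm_num) (neg_lt_zero.2 (by positivity)))
    refine csSup_le (nonempty_Ioi.image _) ?_
    rintro _ ⟨b, hb, rfl⟩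
    rcases le_total B b with h | h
    · exact (hB b h).trans (le_max_left _ _)
    · refine (hGdag b (mem_Ioi.1 hb).le).trans (le_trans ?_ (le_max_right _ _))
      refine neg_le_neg (mul_le_mul_of_nonneg_left (exp_le_exp.2 ?_) hd0.le)
      nlinarith
  · have hbddA : BddAbove ((fun b => Gam lam Phiq Kp Kc W g a1 b) '' Ioi a1) := by
      refine ⟨d, ?_⟩
      rintro _ ⟨b, hb, rfl⟩
      have h := hGle a1 le_rfl b (mem_Ioi.1 hb).le
      have : 0 < d * exp (-Phiq * (b - a1)) := by positivity
      rw [hL1] at h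
      exact h.trans (by linarith)
    obtain ⟨t, ht0, ht⟩ : ∃ t > 0, ∀ y ∈ Icc 0 t, -(Kc - Kp) / 2 ≤ rho W g a1 (y + a1) := by
      have hcw := (hrho a1 le_rfl).1 a1 self_mem_Ici
      have h0 : rho W g a1 a1 = 0 := by simp [rho]
      have hev : ∀ᶠ b in 𝓝[≥] a1, -(Kc - Kp) / 2 < rho W g a1 b :=
        hcw.eventually_const_lt (by rw [h0]; linarith)
      obtain ⟨u, hu, hsub⟩ := mem_nhdsGE_iff_exists_Icc_subset.1 hev
      refine ⟨u - a1, sub_pos.2 hu, fun y hy => (hsub ⟨?_, ?_⟩).le⟩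
      · linarith [hy.1]
      · linarith [hy.2]
    refine lt_of_lt_of_le ?_ (le_csSup hbddA ⟨a1 + t, by simpa using ht0, rfl⟩)
    have hexp : exp (-Phiq * t) < 1 := exp_lt_one_iff.2 (by nlinarith)
    have hlow : (1 - exp (-Phiq * t)) / Phiq * (-(Kc - Kp) / 2) ≤
        ∫ y in (0:ℝ)..t, exp (-Phiq * y) * rho W g a1 (y + a1) := by
      rw [← integral_exp_neg_mul hPhiq.ne', ← intervalIntegral.integral_mul_const]
      refine intervalIntegral.integral_mono_on ht0.le
        (by apply Continuous.intervalIntegrable; fun_prop)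
        (intervalIntegrable_exp_mul_shift (hrho a1 le_rfl).1 Phiq le_rfl ht0.le) fun y hy => ?_
      exact mul_le_mul_of_nonneg_left (ht y hy) (exp_pos _).le
    simp only
    rw [hGam, hL1, add_sub_cancel_left]
    have h1 := mul_le_mul_of_nonneg_left hlow hlam.le
    have h2 : lam * ((1 - exp (-Phiq * t)) / Phiq * (-(Kc - Kp) / 2))
        = -(d * (1 - exp (-Phiq * t)) / 2) := by
      rw [hd]; ring
    have h3 : 0 < d * (1 - exp (-Phiq * t)) := mul_pos hd0 (by linarith)
    linarith
end
end

section
/- Under the standing hypotheses on q, λ, Φ_q, Φ_{q+λ}, W, f, K_c, K_p listed in the context, assume ā₂ < ā₁, assume hypothesis (★), and assume that either lim_{b→∞} ρ_{ā₂}(b) > −∞, or lim_{b→∞} Γ(ā₂, b) > −∞. Then sup_{b > ā₂} Γ(ā₂, b) > 0, and moreover lim_{a ↑ ā₂} sup_{b > a} Γ(a, b) > 0. -/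
open MeasureTheory Filter Set Real

noncomputable section

/-- The right derivative of a convex function is monotone. -/
theorem monotone_of_hasDerivWithinAt_Ici {f f' : ℝ → ℝ} (hf : ConvexOn ℝ Set.univ f)
    (hf' : ∀ x, HasDerivWithinAt f (f' x) (Set.Ici x) x) : Monotone f' := by
  have h : f' = fun x => derivWithin f (Set.Ioi x) x := funext fun x =>
    (((hf' x).Ioi_of_Ici).derivWithin (uniqueDiffWithinAt_Ioi x)).symm
  rw [h, ← monotoneOn_univ]
  simpa using hf.monotoneOn_rightDeriv

theorem isBigO_exp_of_poly_growth {f : ℝ → ℝ} {C M : ℝ} {N : ℕ}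
    (hf : ∀ x : ℝ, M < |x| → |f x| ≤ C * |x| ^ N) {ε : ℝ} (hε : 0 < ε) :
    f =O[atTop] fun x => Real.exp (ε * x) := by
  refine Asymptotics.IsBigO.trans (g := fun x : ℝ => x ^ N) ?_
    (isLittleO_pow_exp_pos_mul_atTop N hε).isBigO
  refine Asymptotics.IsBigO.of_bound C ?_
  filter_upwards [eventually_gt_atTop (max M 0)] with x hx
  have h0 : 0 < x := (le_max_right _ _).trans_lt hx
  have := hf x (by rw [abs_of_pos h0]; exact (le_max_left _ _).trans_lt hx)
  simpa [abs_of_pos h0] using this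

theorem isBigO_exp_rightDeriv {f f' : ℝ → ℝ} (hf : ConvexOn ℝ Set.univ f)
    (hf' : ∀ x, HasDerivWithinAt f (f' x) (Set.Ici x) x) {ε : ℝ}
    (hO : f =O[atTop] fun x => Real.exp (ε * x)) (hε : 0 < ε) :
    f' =O[atTop] fun x => Real.exp (ε * x) := by
  have hm := monotone_of_hasDerivWithinAt_Ici hf hf'
  have hs : (fun x => f (x + 1)) =O[atTop] fun x => Real.exp (ε * x) := by
    refine (hO.comp_tendsto (tendsto_atTop_add_const_right atTop (1 : ℝ) tendsto_id)).trans ?_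
    refine Asymptotics.IsBigO.of_bound (Real.exp ε) (Eventually.of_forall fun x => ?_)
    simp only [Function.comp, id, Real.norm_eq_abs, Real.abs_exp, ← Real.exp_add]
    exact (congrArg _ (by ring)).le
  have hc : (fun _ : ℝ => f' 0) =O[atTop] fun x => Real.exp (ε * x) := by
    refine Asymptotics.IsBigO.of_bound |f' 0| ?_
    filter_upwards [eventually_ge_atTop 0] with x hx
    rw [Real.norm_eq_abs, Real.norm_eq_abs, Real.abs_exp]
    exact le_mul_of_one_le_right (abs_nonneg _) (Real.one_le_exp (by positivity))
  refine Asymptotics.IsBigO.trans (g := fun x => |f (x + 1) - f x| + |f' 0|) ?_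
    ((hs.sub hO).abs_left.add hc.abs_left)
  refine Asymptotics.IsBigO.of_bound 1 ?_
  filter_upwards [eventually_ge_atTop 0] with x hx
  have h1 : f' x ≤ slope f x (x + 1) :=
    hf.le_slope_of_hasDerivWithinAt_Ioi (Set.mem_univ _) (Set.mem_univ _) (by linarith)
      (hf' x).Ioi_of_Ici
  rw [slope_def_field] at h1
  have h2 : f' 0 ≤ f' x := hm hx
  rw [one_mul, Real.norm_eq_abs, Real.norm_eq_abs]
  refine le_trans ?_ (le_abs_self _)
  have h3 := le_abs_self (f (x + 1) - f x)
  have h4 := neg_abs_le (f' 0)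
  simp only [add_sub_cancel_left, div_one] at h1
  rw [abs_le]
  constructor <;> linarith [abs_nonneg (f (x + 1) - f x), abs_nonneg (f' 0)]

theorem exists_abs_shift_le_exp {g : ℝ → ℝ} (hg : Monotone g) {ε : ℝ} (hε : 0 < ε)
    (hO : g =O[atTop] fun x => Real.exp (ε * x)) (a : ℝ) :
    ∃ K, 0 ≤ K ∧ ∀ y, 0 ≤ y → |g (y + a)| ≤ K * Real.exp (ε * y) := by
  obtain ⟨C, hC, h⟩ := hO.exists_pos
  obtain ⟨X, hX⟩ := eventually_atTop.1 h.bound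
  refine ⟨C * Real.exp (ε * a) + (|g a| + |g X|), by positivity, fun y hy => ?_⟩
  have h1 : 1 ≤ Real.exp (ε * y) := Real.one_le_exp (by positivity)
  have hK : 0 ≤ |g a| + |g X| := by positivity
  rcases le_total X (y + a) with hXy | hXy
  · have := hX _ hXy
    rw [Real.norm_eq_abs, Real.norm_eq_abs, Real.abs_exp, mul_add, Real.exp_add] at this
    nlinarith [mul_nonneg hK (Real.exp_pos (ε * y)).le]
  · have h2 : g a ≤ g (y + a) := hg (by linarith)
    have h3 : g (y + a) ≤ g X := hg hXy
    have h4 : |g (y + a)| ≤ |g a| + |g X| := by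
      rw [abs_le]
      constructor <;>
        linarith [neg_abs_le (g a), le_abs_self (g X), abs_nonneg (g a), abs_nonneg (g X)]
    have h5 : 0 ≤ C * Real.exp (ε * a) * Real.exp (ε * y) := by positivity
    nlinarith

theorem integrableOn_exp_mul_shift {g : ℝ → ℝ} (hg : Monotone g)
    (hO : ∀ ε, 0 < ε → g =O[atTop] fun x => Real.exp (ε * x)) {φ : ℝ} (hφ : 0 < φ) (a : ℝ) :
    IntegrableOn (fun y => Real.exp (-φ * y) * g (y + a)) (Set.Ioi 0) := by
  obtain ⟨K, -, hK⟩ := exists_abs_shift_le_exp hg (half_pos hφ) (hO _ (half_pos hφ)) a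
  have hi := (integrableOn_exp_mul_Ioi (a := -(φ / 2)) (by linarith) 0).const_mul K
  refine Integrable.mono' hi ?_ ?_
  · exact ((by fun_prop : Measurable fun y : ℝ => Real.exp (-φ * y)).mul
      (hg.measurable.comp (measurable_add_const a))).aestronglyMeasurable
  · filter_upwards [ae_restrict_mem measurableSet_Ioi] with y hy
    rw [norm_mul, Real.norm_eq_abs, Real.norm_eq_abs, Real.abs_exp]
    calc Real.exp (-φ * y) * |g (y + a)|
        ≤ Real.exp (-φ * y) * (K * Real.exp (φ / 2 * y)) := by
          gcongr; exact hK y (le_of_lt hy)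
      _ = K * Real.exp (-(φ / 2) * y) := by
          rw [mul_left_comm, ← Real.exp_add]; ring_nf

/-- The exponentially weighted integral of a monotone function that is negative somewhere
is negative far to the left. -/
theorem exists_Gam2_neg {g : ℝ → ℝ} (hg : Monotone g)
    (hO : ∀ ε, 0 < ε → g =O[atTop] fun x => Real.exp (ε * x)) {φ : ℝ} (hφ : 0 < φ)
    {m : ℝ} (hm : g m < 0) : ∃ a₀, ∀ a ≤ a₀, Gam2 φ g a < 0 := by
  obtain ⟨K, hK0, hK⟩ := exists_abs_shift_le_exp hg (half_pos hφ) (hO _ (half_pos hφ)) m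
  have hbound : ∀ x, g x ≤ g m + (K - g m) * Real.exp (φ / 2 * (x - m)) := by
    intro x
    rcases le_total x m with h | h
    · have := hg h
      have := mul_nonneg (by linarith : 0 ≤ K - g m) (Real.exp_pos (φ / 2 * (x - m))).le
      linarith
    · have h1 := hK (x - m) (by linarith)
      rw [sub_add_cancel] at h1
      have h2 := le_abs_self (g x)
      have h3 : 1 ≤ Real.exp (φ / 2 * (x - m)) :=
        Real.one_le_exp (mul_nonneg (by linarith) (by linarith))
      nlinarith
  have hle : ∀ a, Gam2 φ g a ≤
      g m / φ + (K - g m) * Real.exp (φ / 2 * (a - m)) * (2 / φ) := by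
    intro a
    have i1 := (integrableOn_exp_mul_Ioi (a := -φ) (by linarith) 0)
    have i2 := (integrableOn_exp_mul_Ioi (a := -(φ / 2)) (by linarith) 0)
    have e1 := integral_exp_mul_Ioi (a := -φ) (by linarith) 0
    have e2 := integral_exp_mul_Ioi (a := -(φ / 2)) (by linarith) 0
    have : Gam2 φ g a ≤ ∫ y in Set.Ioi (0 : ℝ), (g m * Real.exp (-φ * y) +
        (K - g m) * Real.exp (φ / 2 * (a - m)) * Real.exp (-(φ / 2) * y)) := by
      refine integral_mono (integrableOn_exp_mul_shift hg hO hφ a)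
        ((i1.const_mul _).add (i2.const_mul _)) fun y => ?_
      have e : Real.exp (φ / 2 * (a - m)) * Real.exp (-(φ / 2) * y)
          = Real.exp (-φ * y) * Real.exp (φ / 2 * (y + a - m)) := by
        rw [← Real.exp_add, ← Real.exp_add]; ring_nf
      have := mul_le_mul_of_nonneg_left (hbound (y + a)) (Real.exp_pos (-φ * y)).le
      simp only [mul_assoc, e]
      linarith
    refine this.trans_eq ?_
    rw [integral_add (i1.const_mul _) (i2.const_mul _), integral_const_mul, integral_const_mul,
      e1, e2]
    simp
    field_simp
  have hlim : Tendsto (fun a => g m / φ + (K - g m) * Real.exp (φ / 2 * (a - m)) * (2 / φ)) atBot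
      (nhds (g m / φ + (K - g m) * 0 * (2 / φ))) := by
    refine (((Real.tendsto_exp_atBot.comp ?_).const_mul _).mul_const _).const_add _
    exact (tendsto_atBot_add_const_right _ (-m) tendsto_id).const_mul_atBot (half_pos hφ)
  have hneg : g m / φ + (K - g m) * 0 * (2 / φ) < 0 := by
    simpa using div_neg_of_neg_of_pos hm hφ
  obtain ⟨a₀, ha₀⟩ := eventually_atBot.1 (hlim.eventually_lt_const hneg)
  exact ⟨a₀, fun a ha => (hle a).trans_lt (ha₀ a ha)⟩

theorem monotone_exp_mul_scale {W : ℝ → ℝ} {Φ : ℝ}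
    (hW0 : ∀ x < (0 : ℝ), W x = 0) (hWnn : ∀ x ≥ (0 : ℝ), 0 ≤ W x)
    (hWcont : ContinuousOn W (Set.Ici 0)) (hWmono : StrictMonoOn W (Set.Ici 0))
    (hmono : ∀ a y : ℝ, a < y → MonotoneOn (fun b => W (b - y) / W (b - a)) (Set.Ioi y))
    (hlim : ∀ a y : ℝ, a < y → Tendsto (fun b => W (b - y) / W (b - a)) atTop
      (nhds (Real.exp (-Φ * (y - a))))) :
    Monotone fun x => Real.exp (-Φ * x) * W x := by
  have hpos : ∀ x, 0 < x → 0 < W x := fun x hx =>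
    (hWnn 0 le_rfl).trans_lt (hWmono Set.self_mem_Ici hx.le hx)
  have key : ∀ x y, 0 < x → x < y → Real.exp (-Φ * x) * W x ≤ Real.exp (-Φ * y) * W y := by
    intro x y hx hxy
    have hd : (0 : ℝ) < y - x := sub_pos.2 hxy
    have h1 : W (y - (y - x)) / W (y - 0) ≤ Real.exp (-Φ * (y - x - 0)) := by
      refine ge_of_tendsto (hlim 0 (y - x) hd) ?_
      filter_upwards [eventually_ge_atTop y] with b hb
      exact hmono 0 (y - x) hd (by simp [hx]) (by simp only [Set.mem_Ioi]; linarith) hb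
    rw [sub_sub_cancel, sub_zero, sub_zero, div_le_iff₀ (hpos y (hx.trans hxy))] at h1
    calc Real.exp (-Φ * x) * W x ≤ Real.exp (-Φ * x) * (Real.exp (-Φ * (y - x)) * W y) := by gcongr
      _ = Real.exp (-Φ * y) * W y := by rw [← mul_assoc, ← Real.exp_add]; ring_nf
  refine monotone_iff_forall_lt.2 fun x y hxy => ?_
  rcases lt_trichotomy x 0 with hx | rfl | hx
  · rcases lt_or_ge y 0 with hy | hy
    · simp [hW0 x hx, hW0 y hy]
    · simpa [hW0 x hx] using mul_nonneg (Real.exp_pos (-Φ * y)).le (hWnn y hy)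
  · have hc : Tendsto (fun x => Real.exp (-Φ * x) * W x) (nhdsWithin 0 (Set.Ioi 0))
        (nhds (Real.exp (-Φ * 0) * W 0)) :=
      ((by fun_prop : Continuous fun x : ℝ => Real.exp (-Φ * x)).continuousWithinAt.mul
        ((hWcont 0 Set.self_mem_Ici).mono Set.Ioi_subset_Ici_self)).tendsto
    refine le_of_tendsto hc ?_
    filter_upwards [Ioo_mem_nhdsGT hxy] with z hz using key z y hz.1 hz.2
  · exact key x y hx hxy

theorem monotone_scale {W : ℝ → ℝ}
    (hW0 : ∀ x < (0 : ℝ), W x = 0) (hWnn : ∀ x ≥ (0 : ℝ), 0 ≤ W x)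
    (hWmono : StrictMonoOn W (Set.Ici 0)) : Monotone W := by
  intro x y hxy
  rcases lt_or_ge x 0 with hx | hx
  · rcases lt_or_ge y 0 with hy | hy
    · rw [hW0 x hx, hW0 y hy]
    · rw [hW0 x hx]; exact hWnn y hy
  · exact hWmono.monotoneOn hx (hx.trans hxy) hxy

/-- `rho` at distance `y` from its starting point, as an integral over a fixed half-line. -/
def rhoShift (W g : ℝ → ℝ) (a y : ℝ) : ℝ :=
  ∫ z in Set.Ioi (0 : ℝ), g (z + a) * W (y - z)

theorem rho_add {W g : ℝ → ℝ} (hW0 : ∀ x < (0 : ℝ), W x = 0) (a : ℝ) {y : ℝ} (hy : 0 ≤ y) :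
    rho W g a (y + a) = rhoShift W g a y := by
  have h1 : rho W g a (y + a) = ∫ z in (0 : ℝ)..y, g (z + a) * W (y - z) := by
    have := intervalIntegral.integral_comp_add_right
      (a := 0) (b := y) (fun u => g u * W (y + a - u)) a
    simp only [zero_add, add_sub_add_right_eq_sub] at this
    exact this.symm
  rw [h1, intervalIntegral.integral_of_le hy, rhoShift]
  refine (setIntegral_eq_of_subset_of_forall_sdiff_eq_zero measurableSet_Ioi
    Set.Ioc_subset_Ioi_self fun z hz => ?_).symm
  have : y < z := by
    by_contra h
    exact hz.2 ⟨hz.1, not_lt.1 h⟩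
  rw [hW0 _ (by linarith), mul_zero]

section

variable {W g : ℝ → ℝ} {Φ : ℝ}

theorem scale_sub_le (hV : Monotone fun x => Real.exp (-Φ * x) * W x) (y : ℝ) {z : ℝ} (hz : 0 ≤ z) :
    W (y - z) ≤ W y * Real.exp (-Φ * z) := by
  have h : Real.exp (-Φ * (y - z)) * W (y - z) ≤ Real.exp (-Φ * y) * W y :=
    hV (by linarith : y - z ≤ y)
  have h2 := mul_le_mul_of_nonneg_left h (Real.exp_pos (Φ * (y - z))).le
  rw [← mul_assoc, ← mul_assoc, ← Real.exp_add, ← Real.exp_add] at h2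
  ring_nf at h2 ⊢
  simpa [mul_comm] using h2

theorem integrableOn_mul_scale (hg : Monotone g)
    (hO : ∀ ε, 0 < ε → g =O[atTop] fun x => Real.exp (ε * x)) (hΦ : 0 < Φ)
    (hWm : Monotone W) (hW : ∀ x, 0 ≤ W x)
    (hV : Monotone fun x => Real.exp (-Φ * x) * W x) (a y : ℝ) :
    IntegrableOn (fun z => g (z + a) * W (y - z)) (Set.Ioi 0) := by
  refine Integrable.mono' ((integrableOn_exp_mul_shift hg hO hΦ a).norm.const_mul (W y)) ?_ ?_
  · exact ((hg.measurable.comp (measurable_add_const a)).mul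
      (hWm.measurable.comp (measurable_const.sub measurable_id))).aestronglyMeasurable
  · filter_upwards [ae_restrict_mem measurableSet_Ioi] with z hz
    have := scale_sub_le hV y (le_of_lt hz)
    rw [norm_mul, norm_mul, Real.norm_eq_abs, Real.norm_eq_abs, Real.norm_eq_abs, Real.abs_exp,
      abs_of_nonneg (hW _)]
    calc |g (z + a)| * W (y - z) ≤ |g (z + a)| * (W y * Real.exp (-Φ * z)) := by gcongr
      _ = _ := by ring

theorem abs_rhoShift_le (hg : Monotone g)
    (hO : ∀ ε, 0 < ε → g =O[atTop] fun x => Real.exp (ε * x)) (hΦ : 0 < Φ) (hW : ∀ x, 0 ≤ W x)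
    (hV : Monotone fun x => Real.exp (-Φ * x) * W x) (a y : ℝ) :
    |rhoShift W g a y| ≤ W y * ∫ z in Set.Ioi (0 : ℝ), ‖Real.exp (-Φ * z) * g (z + a)‖ := by
  rw [← integral_const_mul, ← Real.norm_eq_abs]
  refine norm_integral_le_of_norm_le
    ((integrableOn_exp_mul_shift hg hO hΦ a).norm.const_mul (W y)) ?_
  filter_upwards [ae_restrict_mem measurableSet_Ioi] with z hz
  have := scale_sub_le hV y (le_of_lt hz)
  rw [norm_mul, norm_mul, Real.norm_eq_abs, Real.norm_eq_abs, Real.norm_eq_abs, Real.abs_exp,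
    abs_of_nonneg (hW _)]
  calc |g (z + a)| * W (y - z) ≤ |g (z + a)| * (W y * Real.exp (-Φ * z)) := by gcongr
    _ = _ := by ring

theorem stronglyMeasurable_rhoShift (hg : Monotone g) (hWm : Monotone W) (a : ℝ) :
    StronglyMeasurable (rhoShift W g a) := by
  refine StronglyMeasurable.integral_prod_right ?_
  refine Measurable.stronglyMeasurable ?_
  exact (hg.measurable.comp (measurable_snd.add_const a)).mul
    (hWm.measurable.comp (measurable_fst.sub measurable_snd))

theorem intervalIntegrable_exp_mul_rhoShift (hg : Monotone g)
    (hO : ∀ ε, 0 < ε → g =O[atTop] fun x => Real.exp (ε * x)) (hΦ : 0 < Φ)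
    (hWm : Monotone W) (hW : ∀ x, 0 ≤ W x)
    (hV : Monotone fun x => Real.exp (-Φ * x) * W x) (φ a x₁ x₂ : ℝ) :
    IntervalIntegrable (fun y => Real.exp (-φ * y) * rhoShift W g a y) volume x₁ x₂ := by
  refine IntervalIntegrable.continuousOn_mul ?_ (by fun_prop)
  have hi := (hWm.intervalIntegrable (μ := volume) (a := x₁) (b := x₂)).mul_const
    (∫ z in Set.Ioi (0 : ℝ), ‖Real.exp (-Φ * z) * g (z + a)‖)
  refine hi.mono_fun' (stronglyMeasurable_rhoShift hg hWm a).aestronglyMeasurable ?_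
  exact Eventually.of_forall fun y => abs_rhoShift_le hg hO hΦ hW hV a y

theorem rhoShift_mono (hg : Monotone g)
    (hO : ∀ ε, 0 < ε → g =O[atTop] fun x => Real.exp (ε * x)) (hΦ : 0 < Φ)
    (hWm : Monotone W) (hW : ∀ x, 0 ≤ W x)
    (hV : Monotone fun x => Real.exp (-Φ * x) * W x) (y : ℝ) :
    Monotone fun a => rhoShift W g a y := fun a b hab =>
  integral_mono (integrableOn_mul_scale hg hO hΦ hWm hW hV a y)
    (integrableOn_mul_scale hg hO hΦ hWm hW hV b y) fun z =>
      mul_le_mul_of_nonneg_right (hg (by linarith)) (hW _)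

/-- Single-crossing comparison: the scale-weighted average of a monotone function is nonpositive
as soon as its exponentially weighted average is. -/
theorem rhoShift_nonpos (hg : Monotone g)
    (hO : ∀ ε, 0 < ε → g =O[atTop] fun x => Real.exp (ε * x)) (hΦ : 0 < Φ)
    (hWm : Monotone W) (hW : ∀ x, 0 ≤ W x)
    (hV : Monotone fun x => Real.exp (-Φ * x) * W x)
    (hne : {x | 0 ≤ g x}.Nonempty) (hbdd : BddBelow {x | 0 ≤ g x})
    {a : ℝ} (ha : Gam2 Φ g a ≤ 0) (y : ℝ) : rhoShift W g a y ≤ 0 := by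
  set c := sInf {x | 0 ≤ g x} with hc
  have hneg : ∀ x, x < c → g x < 0 := fun x hx => not_le.1 fun h =>
    hx.not_ge (csInf_le hbdd h)
  have hnn : ∀ x, c < x → 0 ≤ g x := fun x hx => by
    obtain ⟨t, ht, htx⟩ := exists_lt_of_csInf_lt hne hx
    exact le_trans ht (hg htx.le)
  set h : ℝ → ℝ := fun z => Real.exp (-Φ * (y - z)) * W (y - z) with hh
  have hanti : ∀ z z', z ≤ z' → h z' ≤ h z := fun z z' hz => hV (by linarith : y - z' ≤ y - z)
  have hle : rhoShift W g a y ≤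
      ∫ z in Set.Ioi (0 : ℝ), Real.exp (Φ * y) * h (c - a) * (Real.exp (-Φ * z) * g (z + a)) := by
    refine integral_mono (integrableOn_mul_scale hg hO hΦ hWm hW hV a y)
      ((integrableOn_exp_mul_shift hg hO hΦ a).const_mul _) fun z => ?_
    have e : g (z + a) * W (y - z) = Real.exp (Φ * y) * Real.exp (-Φ * z) * (g (z + a) * h z) := by
      have : Real.exp (Φ * y) * Real.exp (-Φ * z) * Real.exp (-Φ * (y - z)) = 1 := by
        rw [← Real.exp_add, ← Real.exp_add, ← Real.exp_zero]; ring_nf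
      calc g (z + a) * W (y - z)
          = (Real.exp (Φ * y) * Real.exp (-Φ * z) * Real.exp (-Φ * (y - z))) *
            (g (z + a) * W (y - z)) := by rw [this, one_mul]
        _ = _ := by simp only [hh]; ring
    have h1 : g (z + a) * h z ≤ g (z + a) * h (c - a) := by
      rcases lt_trichotomy (z + a) c with hz | hz | hz
      · exact mul_le_mul_of_nonpos_left (hanti _ _ (by linarith)) (hneg _ hz).le
      · rw [← hz, add_sub_cancel_right]
      · exact mul_le_mul_of_nonneg_left (hanti _ _ (by linarith)) (hnn _ hz)
    calc g (z + a) * W (y - z) = _ := e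
      _ ≤ Real.exp (Φ * y) * Real.exp (-Φ * z) * (g (z + a) * h (c - a)) := by gcongr
      _ = _ := by ring
  refine hle.trans ?_
  rw [integral_const_mul]
  exact mul_nonpos_of_nonneg_of_nonpos
    (mul_nonneg (Real.exp_pos _).le (mul_nonneg (Real.exp_pos _).le (hW _))) ha

theorem ae_tendsto_shift (hg : Monotone g) (a : ℝ) :
    ∀ᵐ y : ℝ, Tendsto (fun b => g (y + b)) (nhds a) (nhds (g (y + a))) := by
  have hc := hg.countable_not_continuousAt.preimage (add_left_injective a)
  filter_upwards [hc.ae_notMem volume] with y hy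
  have hy' : ContinuousAt g (y + a) := by simpa using hy
  exact hy'.tendsto.comp (tendsto_id.const_add y)

theorem abs_shift_le (hg : Monotone g) {a b : ℝ} (h1 : a - 1 ≤ b) (h2 : b ≤ a) (y : ℝ) :
    |g (y + b)| ≤ |g (y + (a - 1))| + |g (y + a)| := by
  have h3 : g (y + (a - 1)) ≤ g (y + b) := hg (by linarith)
  have h4 : g (y + b) ≤ g (y + a) := hg (by linarith)
  rw [abs_le]
  constructor <;> linarith [neg_abs_le (g (y + (a - 1))), le_abs_self (g (y + a)),
    abs_nonneg (g (y + (a - 1))), abs_nonneg (g (y + a))]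

theorem eventually_mem_Icc_sub_one (a : ℝ) :
    ∀ᶠ b in nhdsWithin a (Set.Iio a), a - 1 ≤ b ∧ b ≤ a := by
  filter_upwards [Ioo_mem_nhdsLT (sub_one_lt a)] with b hb using ⟨hb.1.le, hb.2.le⟩

/-- Left continuity under the integral sign for monotone integrands. -/
theorem tendsto_integral_mul_shift (hg : Monotone g) {w : ℝ → ℝ} (hwm : Measurable w)
    (hw : ∀ b, IntegrableOn (fun y => g (y + b) * w y) (Set.Ioi 0)) (a : ℝ) :
    Tendsto (fun b => ∫ y in Set.Ioi (0 : ℝ), g (y + b) * w y) (nhdsWithin a (Set.Iio a))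
      (nhds (∫ y in Set.Ioi (0 : ℝ), g (y + a) * w y)) := by
  refine tendsto_integral_filter_of_dominated_convergence
    (fun y => ‖g (y + (a - 1)) * w y‖ + ‖g (y + a) * w y‖) ?_ ?_
    ((hw (a - 1)).norm.add (hw a).norm) ?_
  · exact Eventually.of_forall fun b =>
      ((hg.measurable.comp (measurable_add_const b)).mul hwm).aestronglyMeasurable
  · filter_upwards [eventually_mem_Icc_sub_one a] with b hb
    refine Eventually.of_forall fun y => ?_
    simp only [norm_mul, Real.norm_eq_abs, ← add_mul]
    exact mul_le_mul_of_nonneg_right (abs_shift_le hg hb.1 hb.2 y) (abs_nonneg _)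
  · filter_upwards [ae_restrict_of_ae (ae_tendsto_shift hg a)] with y hy
    exact (hy.mono_left nhdsWithin_le_nhds).mul_const _

theorem tendsto_rhoShift (hg : Monotone g)
    (hO : ∀ ε, 0 < ε → g =O[atTop] fun x => Real.exp (ε * x)) (hΦ : 0 < Φ)
    (hWm : Monotone W) (hW : ∀ x, 0 ≤ W x)
    (hV : Monotone fun x => Real.exp (-Φ * x) * W x) (a y : ℝ) :
    Tendsto (fun b => rhoShift W g b y) (nhdsWithin a (Set.Iio a))
      (nhds (rhoShift W g a y)) :=
  tendsto_integral_mul_shift hg (hWm.measurable.comp (measurable_const.sub measurable_id))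
    (fun b => integrableOn_mul_scale hg hO hΦ hWm hW hV b y) a

theorem tendsto_integral_exp_mul_rhoShift (hg : Monotone g)
    (hO : ∀ ε, 0 < ε → g =O[atTop] fun x => Real.exp (ε * x)) (hΦ : 0 < Φ)
    (hWm : Monotone W) (hW : ∀ x, 0 ≤ W x)
    (hV : Monotone fun x => Real.exp (-Φ * x) * W x) (φ a x : ℝ) :
    Tendsto (fun b => ∫ y in (0 : ℝ)..x, Real.exp (-φ * y) * rhoShift W g b y)
      (nhdsWithin a (Set.Iio a))
      (nhds (∫ y in (0 : ℝ)..x, Real.exp (-φ * y) * rhoShift W g a y)) := by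
  have hi := intervalIntegrable_exp_mul_rhoShift hg hO hΦ hWm hW hV φ
  refine intervalIntegral.tendsto_integral_filter_of_dominated_convergence
    (fun y => ‖Real.exp (-φ * y) * rhoShift W g (a - 1) y‖ +
      ‖Real.exp (-φ * y) * rhoShift W g a y‖) ?_ ?_ ((hi _ _ _).norm.add (hi _ _ _).norm) ?_
  · exact Eventually.of_forall fun b =>
      ((by fun_prop : Measurable fun y : ℝ => Real.exp (-φ * y)).mul
        (stronglyMeasurable_rhoShift hg hWm b).measurable).aestronglyMeasurable
  · filter_upwards [eventually_mem_Icc_sub_one a] with b hb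
    refine Eventually.of_forall fun y _ => ?_
    have h1 : rhoShift W g (a - 1) y ≤ rhoShift W g b y :=
      rhoShift_mono hg hO hΦ hWm hW hV y hb.1
    have h2 : rhoShift W g b y ≤ rhoShift W g a y := rhoShift_mono hg hO hΦ hWm hW hV y hb.2
    simp only [norm_mul, Real.norm_eq_abs, ← mul_add]
    refine mul_le_mul_of_nonneg_left ?_ (abs_nonneg _)
    rw [abs_le]
    constructor <;> linarith [neg_abs_le (rhoShift W g (a - 1) y), le_abs_self (rhoShift W g a y),
      abs_nonneg (rhoShift W g (a - 1) y), abs_nonneg (rhoShift W g a y)]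
  · exact Eventually.of_forall fun y _ =>
      (tendsto_rhoShift hg hO hΦ hWm hW hV a y).const_mul _

end

theorem intervalIntegral_exp_mul {c : ℝ} (hc : c ≠ 0) (x₁ x₂ : ℝ) :
    ∫ y in x₁..x₂, Real.exp (c * y) = (Real.exp (c * x₂) - Real.exp (c * x₁)) / c := by
  rw [intervalIntegral.integral_comp_mul_left (fun y => Real.exp y) hc, integral_exp, smul_eq_mul,
    inv_mul_eq_div]

section

variable {W g : ℝ → ℝ} {Φ : ℝ}

theorem Gam_add (hW0 : ∀ x < (0 : ℝ), W x = 0) (lam φ Kp Kc a : ℝ) {x : ℝ} (hx : 0 ≤ x) :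
    Gam lam φ Kp Kc W g a (x + a) =
      (∫ y in Set.Ioi (0 : ℝ), Real.exp (-φ * y) * g (y + a)) +
      lam * (∫ y in (0 : ℝ)..x, Real.exp (-φ * y) * rhoShift W g a y) +
      lam / φ * Real.exp (-φ * x) * (Kp - Kc) := by
  rw [Gam, add_sub_cancel_right]
  congr 3
  refine intervalIntegral.integral_congr fun y hy => ?_
  rw [Set.uIcc_of_le hx] at hy
  simp only [rho_add hW0 a hy.1]

theorem intervalIntegrable_exp_mul_gam (hW0 : ∀ x < (0 : ℝ), W x = 0) (hg : Monotone g)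
    (hO : ∀ ε, 0 < ε → g =O[atTop] fun x => Real.exp (ε * x)) (hΦ : 0 < Φ)
    (hWm : Monotone W) (hW : ∀ x, 0 ≤ W x)
    (hV : Monotone fun x => Real.exp (-Φ * x) * W x) (φ Kp Kc a : ℝ)
    {x₁ x₂ : ℝ} (h1 : 0 ≤ x₁) (h2 : 0 ≤ x₂) :
    IntervalIntegrable (fun y => Real.exp (-φ * y) * gam Kp Kc W g a (y + a)) volume x₁ x₂ := by
  have hi := (intervalIntegrable_exp_mul_rhoShift hg hO hΦ hWm hW hV φ a x₁ x₂).neg.add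
    ((by fun_prop : Continuous fun y : ℝ => Real.exp (-φ * y) * (Kp - Kc)).intervalIntegrable x₁ x₂)
  refine hi.congr fun y hy => ?_
  have hy0 : 0 ≤ y := (le_min h1 h2).trans hy.1.le
  simp only [gam, rho_add hW0 a hy0, Pi.neg_apply]
  ring

theorem Gam_sub_Gam (hW0 : ∀ x < (0 : ℝ), W x = 0) (hg : Monotone g)
    (hO : ∀ ε, 0 < ε → g =O[atTop] fun x => Real.exp (ε * x)) (hΦ : 0 < Φ)
    (hWm : Monotone W) (hW : ∀ x, 0 ≤ W x)
    (hV : Monotone fun x => Real.exp (-Φ * x) * W x) (lam Kp Kc a : ℝ) {φ : ℝ} (hφ : 0 < φ)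
    {x₁ x₂ : ℝ} (h1 : 0 ≤ x₁) (h2 : 0 ≤ x₂) :
    Gam lam φ Kp Kc W g a (x₂ + a) - Gam lam φ Kp Kc W g a (x₁ + a) =
      -lam * ∫ y in x₁..x₂, Real.exp (-φ * y) * gam Kp Kc W g a (y + a) := by
  have hi := intervalIntegrable_exp_mul_rhoShift hg hO hΦ hWm hW hV φ a
  have hexp : ∫ y in x₁..x₂, Real.exp (-φ * y) * (Kp - Kc) =
      (Real.exp (-φ * x₂) - Real.exp (-φ * x₁)) / -φ * (Kp - Kc) := by
    rw [intervalIntegral.integral_mul_const, intervalIntegral_exp_mul (neg_ne_zero.2 hφ.ne')]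
  have hsplit : ∫ y in x₁..x₂, Real.exp (-φ * y) * gam Kp Kc W g a (y + a) =
      -(∫ y in x₁..x₂, Real.exp (-φ * y) * rhoShift W g a y) +
        ∫ y in x₁..x₂, Real.exp (-φ * y) * (Kp - Kc) := by
    have hc : IntervalIntegrable (fun y => Real.exp (-φ * y) * (Kp - Kc)) volume x₁ x₂ :=
      Continuous.intervalIntegrable (by fun_prop) _ _
    rw [add_comm, ← sub_eq_add_neg, ← intervalIntegral.integral_sub hc (hi _ _)]
    refine intervalIntegral.integral_congr fun y hy => ?_
    have hy0 : 0 ≤ y := (le_min h1 h2).trans hy.1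
    simp only [gam, rho_add hW0 a hy0]
    ring
  rw [Gam_add hW0 _ _ _ _ _ h1, Gam_add hW0 _ _ _ _ _ h2, hsplit, hexp,
    ← intervalIntegral.integral_add_adjacent_intervals (hi 0 x₁) (hi x₁ x₂)]
  field_simp
  ring

theorem Gam_add_mono (hW0 : ∀ x < (0 : ℝ), W x = 0) (hg : Monotone g)
    (hO : ∀ ε, 0 < ε → g =O[atTop] fun x => Real.exp (ε * x)) (hΦ : 0 < Φ)
    (hWm : Monotone W) (hW : ∀ x, 0 ≤ W x)
    (hV : Monotone fun x => Real.exp (-Φ * x) * W x) {lam φ : ℝ} (hlam : 0 < lam) (hφ : 0 < φ)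
    (Kp Kc : ℝ) {x : ℝ} (hx : 0 ≤ x) :
    Monotone fun a => Gam lam φ Kp Kc W g a (x + a) := by
  intro a b hab
  have hi := intervalIntegrable_exp_mul_rhoShift hg hO hΦ hWm hW hV φ
  simp only [Gam_add hW0 _ _ _ _ _ hx]
  have h1 := integral_mono (integrableOn_exp_mul_shift hg hO hφ a)
    (integrableOn_exp_mul_shift hg hO hφ b) fun y =>
      mul_le_mul_of_nonneg_left (hg (by linarith : y + a ≤ y + b)) (Real.exp_pos _).le
  have h2 := intervalIntegral.integral_mono_on hx (hi a 0 x) (hi b 0 x) fun y _ =>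
    mul_le_mul_of_nonneg_left (rhoShift_mono hg hO hΦ hWm hW hV y hab) (Real.exp_pos _).le
  exact add_le_add (add_le_add h1 (mul_le_mul_of_nonneg_left h2 hlam.le)) le_rfl

theorem tendsto_Gam_add (hW0 : ∀ x < (0 : ℝ), W x = 0) (hg : Monotone g)
    (hO : ∀ ε, 0 < ε → g =O[atTop] fun x => Real.exp (ε * x)) (hΦ : 0 < Φ)
    (hWm : Monotone W) (hW : ∀ x, 0 ≤ W x)
    (hV : Monotone fun x => Real.exp (-Φ * x) * W x) {φ : ℝ} (hφ : 0 < φ)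
    (lam Kp Kc a : ℝ) {x : ℝ} (hx : 0 ≤ x) :
    Tendsto (fun b => Gam lam φ Kp Kc W g b (x + b)) (nhdsWithin a (Set.Iio a))
      (nhds (Gam lam φ Kp Kc W g a (x + a))) := by
  simp only [Gam_add hW0 _ _ _ _ _ hx]
  refine Tendsto.add_const _ (Tendsto.add ?_
    ((tendsto_integral_exp_mul_rhoShift hg hO hΦ hWm hW hV φ a x).const_mul lam))
  have := tendsto_integral_mul_shift hg
    (by fun_prop : Measurable fun y : ℝ => Real.exp (-φ * y))
    (fun b => by simpa only [mul_comm] using integrableOn_exp_mul_shift hg hO hφ b) a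
  simpa only [mul_comm] using this

theorem Gam_add_le (hW0 : ∀ x < (0 : ℝ), W x = 0) (hg : Monotone g)
    (hO : ∀ ε, 0 < ε → g =O[atTop] fun x => Real.exp (ε * x)) (hΦ : 0 < Φ)
    (hWm : Monotone W) (hW : ∀ x, 0 ≤ W x)
    (hV : Monotone fun x => Real.exp (-Φ * x) * W x)
    (hne : {x | 0 ≤ g x}.Nonempty) (hbdd : BddBelow {x | 0 ≤ g x})
    {lam φ Kp Kc : ℝ} (hlam : 0 < lam) (hφ : 0 < φ) (hK : Kp < Kc) {a : ℝ} (ha : Gam2 Φ g a ≤ 0)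
    {x : ℝ} (hx : 0 ≤ x) :
    Gam lam φ Kp Kc W g a (x + a) ≤ ∫ y in Set.Ioi (0 : ℝ), Real.exp (-φ * y) * g (y + a) := by
  rw [Gam_add hW0 _ _ _ _ _ hx]
  have h1 : ∫ y in (0 : ℝ)..x, Real.exp (-φ * y) * rhoShift W g a y ≤ 0 := by
    have h := intervalIntegral.integral_mono_on hx
      (intervalIntegrable_exp_mul_rhoShift hg hO hΦ hWm hW hV φ a 0 x)
      (intervalIntegrable_const (c := (0 : ℝ))) fun y _ => mul_nonpos_of_nonneg_of_nonpos
        (Real.exp_pos _).le (rhoShift_nonpos hg hO hΦ hWm hW hV hne hbdd ha y)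
    simpa using h
  have h2 : lam / φ * Real.exp (-φ * x) * (Kp - Kc) ≤ 0 :=
    mul_nonpos_of_nonneg_of_nonpos (by positivity) (by linarith)
  nlinarith

theorem one_le_Theta (hW : ∀ x, 0 ≤ W x) {lam : ℝ} (hlam : 0 < lam) (φ : ℝ) {x : ℝ} (hx : 0 ≤ x) :
    1 ≤ Theta lam φ W x := by
  have : 0 ≤ ∫ y in (0 : ℝ)..x, Real.exp (-φ * y) * W y :=
    intervalIntegral.integral_nonneg hx fun y _ => mul_nonneg (Real.exp_pos _).le (hW y)
  rw [Theta]
  nlinarith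

theorem intervalIntegrable_exp_mul_scale (hWm : Monotone W) (φ x₁ x₂ : ℝ) :
    IntervalIntegrable (fun y => Real.exp (-φ * y) * W y) volume x₁ x₂ :=
  hWm.intervalIntegrable.continuousOn_mul (by fun_prop)

theorem exp_mul_Zfun_le_Theta (hWm : Monotone W) (hW : ∀ x, 0 ≤ W x) {q lam φ : ℝ} (hq : 0 < q)
    (hlam : 0 < lam) (hφ : 0 < φ) {x : ℝ} (hx : 0 ≤ x) :
    lam * Real.exp (-φ * x) * Zfun q lam W x ≤ (lam + q) * Theta lam φ W x := by
  have hexp : Real.exp (-φ * x) ≤ 1 := Real.exp_le_one_iff.2 (by nlinarith)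
  have hintg : Real.exp (-φ * x) * (∫ y in (0 : ℝ)..x, W y) ≤
      ∫ y in (0 : ℝ)..x, Real.exp (-φ * y) * W y := by
    rw [← intervalIntegral.integral_const_mul]
    refine intervalIntegral.integral_mono_on hx (hWm.intervalIntegrable.const_mul _)
      (intervalIntegrable_exp_mul_scale hWm φ 0 x) fun y hy => ?_
    exact mul_le_mul_of_nonneg_right
      (Real.exp_le_exp.2 (by nlinarith [mul_le_mul_of_nonneg_left hy.2 hφ.le])) (hW y)
  rw [Zfun, Theta, max_eq_left hx]
  have h1 := mul_le_mul_of_nonneg_left hintg (by positivity : 0 ≤ lam * (lam + q))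
  have h2 := mul_le_mul_of_nonneg_left hexp hlam.le
  linarith

theorem exists_le_Zfun_div_Theta (hWm : Monotone W) (hW : ∀ x, 0 ≤ W x) (hW1 : 0 < W 1)
    (hV : Monotone fun x => Real.exp (-Φ * x) * W x)
    {L : ℝ} (hL : 0 < L) (hVL : ∀ x, Real.exp (-Φ * x) * W x ≤ L)
    {q lam φ : ℝ} (hq : 0 < q) (hlam : 0 < lam) (hφΦ : φ < Φ) :
    ∃ c, 0 < c ∧ ∀ x, 2 ≤ x → c * Real.exp (φ * x) ≤ Zfun q lam W x / Theta lam φ W x := by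
  have hd : 0 < Φ - φ := sub_pos.2 hφΦ
  set A := 1 + lam * (L / (Φ - φ)) with hA
  set B := (q + lam) * (Real.exp (-Φ * 1) * W 1 * Real.exp (-Φ)) with hB
  have hApos : 0 < A := by positivity
  have hBpos : 0 < B := by positivity
  have hTheta : ∀ x, 0 ≤ x → Theta lam φ W x ≤ A * Real.exp ((Φ - φ) * x) := by
    intro x hx
    have hintg : ∫ y in (0 : ℝ)..x, Real.exp (-φ * y) * W y ≤
        ∫ y in (0 : ℝ)..x, L * Real.exp ((Φ - φ) * y) := by
      refine intervalIntegral.integral_mono_on hx (intervalIntegrable_exp_mul_scale hWm φ 0 x)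
        (Continuous.intervalIntegrable (by fun_prop) _ _) fun y _ => ?_
      have e : Real.exp (-φ * y) = Real.exp ((Φ - φ) * y) * Real.exp (-Φ * y) := by
        rw [← Real.exp_add]; ring_nf
      rw [e, mul_assoc, mul_comm L]
      gcongr
      exact hVL y
    have hval : ∫ y in (0 : ℝ)..x, L * Real.exp ((Φ - φ) * y) =
        L / (Φ - φ) * Real.exp ((Φ - φ) * x) - L / (Φ - φ) := by
      rw [intervalIntegral.integral_const_mul, intervalIntegral_exp_mul hd.ne', mul_zero,
        Real.exp_zero]
      ring
    have h1 : 1 ≤ Real.exp ((Φ - φ) * x) := Real.one_le_exp (by positivity)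
    have h2 : 0 ≤ L / (Φ - φ) := by positivity
    rw [hval] at hintg
    have h3 := mul_le_mul_of_nonneg_left hintg hlam.le
    have h4 := mul_nonneg hlam.le h2
    rw [Theta, hA]
    linarith
  have hZ : ∀ x, 2 ≤ x → B * Real.exp (Φ * x) ≤ Zfun q lam W x := by
    intro x hx
    have i := fun a b : ℝ => (hWm.intervalIntegrable : IntervalIntegrable W volume a b)
    have h1 : 0 ≤ ∫ y in (0 : ℝ)..(x - 1), W y :=
      intervalIntegral.integral_nonneg (by linarith) fun y _ => hW y
    have h2 : W (x - 1) ≤ ∫ y in (x - 1)..x, W y := by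
      have := intervalIntegral.integral_mono_on (by linarith : x - 1 ≤ x)
        (intervalIntegrable_const (c := W (x - 1))) (i (x - 1) x) fun y hy => hWm hy.1
      simpa using this
    have h3 : Real.exp (-Φ * 1) * W 1 ≤ Real.exp (-Φ * (x - 1)) * W (x - 1) :=
      hV (by linarith : 1 ≤ x - 1)
    have h4 : Real.exp (-Φ * 1) * W 1 * Real.exp (-Φ) * Real.exp (Φ * x) ≤ W (x - 1) := by
      have e : Real.exp (-Φ) * Real.exp (Φ * x) * Real.exp (-Φ * (x - 1)) = 1 := by
        rw [← Real.exp_add, ← Real.exp_add, Real.exp_eq_one_iff]; ring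
      calc _ = Real.exp (-Φ) * Real.exp (Φ * x) * (Real.exp (-Φ * 1) * W 1) := by ring
        _ ≤ Real.exp (-Φ) * Real.exp (Φ * x) * (Real.exp (-Φ * (x - 1)) * W (x - 1)) := by gcongr
        _ = W (x - 1) := by rw [← mul_assoc, e, one_mul]
    have h5 := intervalIntegral.integral_add_adjacent_intervals (i 0 (x - 1)) (i (x - 1) x)
    rw [Zfun, max_eq_left (by linarith), hB, mul_assoc, ← h5]
    have h6 := mul_le_mul_of_nonneg_left (h4.trans (h2.trans (le_add_of_nonneg_left h1)))
      (by positivity : 0 ≤ q + lam)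
    linarith
  refine ⟨B / A, by positivity, fun x hx => ?_⟩
  have hT : 0 < Theta lam φ W x := one_pos.trans_le (one_le_Theta hW hlam φ (by linarith))
  rw [le_div_iff₀ hT]
  calc B / A * Real.exp (φ * x) * Theta lam φ W x
      ≤ B / A * Real.exp (φ * x) * (A * Real.exp ((Φ - φ) * x)) := by
        gcongr; exact hTheta x (by linarith)
    _ = B * (Real.exp (φ * x) * Real.exp ((Φ - φ) * x)) := by field_simp
    _ = B * Real.exp (Φ * x) := by rw [← Real.exp_add]; ring_nf
    _ ≤ _ := hZ x hx

end

/-- If the combination of `Gam` and `gam` in the fluctuation identity is eventually positive and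
`rho` or `Gam` converges, then `Gam` takes a positive value. -/
theorem exists_Gam_pos {W g : ℝ → ℝ} {Φ : ℝ} (hW0 : ∀ x < (0 : ℝ), W x = 0) (hg : Monotone g)
    (hO : ∀ ε, 0 < ε → g =O[atTop] fun x => Real.exp (ε * x)) (hΦ : 0 < Φ)
    (hWm : Monotone W) (hW : ∀ x, 0 ≤ W x) (hW1 : 0 < W 1)
    (hV : Monotone fun x => Real.exp (-Φ * x) * W x)
    {L : ℝ} (hL : 0 < L) (hVL : ∀ x, Real.exp (-Φ * x) * W x ≤ L)
    {q lam φ Kp Kc a : ℝ} (hq : 0 < q) (hlam : 0 < lam) (hφ : 0 < φ) (hφΦ : φ < Φ)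
    (hstar : ∀ᶠ b in atTop, 0 <
      (φ / q * Gam lam φ Kp Kc W g a b - lam / q * Real.exp (-φ * (b - a)) * gam Kp Kc W g a b)
        * Zfun q lam W (b - a) / Theta lam φ W (b - a) + (lam + q) / q * gam Kp Kc W g a b)
    (hcase : (∃ l : ℝ, Tendsto (fun b => rho W g a b) atTop (nhds l)) ∨
      ∃ l : ℝ, Tendsto (fun b => Gam lam φ Kp Kc W g a b) atTop (nhds l)) :
    ∃ x, 0 < x ∧ 0 < Gam lam φ Kp Kc W g a (x + a) := by
  by_contra! hneg
  have hshift : Tendsto (fun x : ℝ => x + a) atTop atTop :=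
    tendsto_atTop_add_const_right _ a tendsto_id
  obtain ⟨c₀, hc₀, hZT⟩ := exists_le_Zfun_div_Theta hWm hW hW1 hV hL hVL hq hlam hφΦ
  set c := φ * c₀ / (lam + q) with hc
  have hcpos : 0 < c := by positivity
  have key : ∀ᶠ x in atTop, 0 < gam Kp Kc W g a (x + a) ∧
      c * Real.exp (φ * x) * -Gam lam φ Kp Kc W g a (x + a) ≤ gam Kp Kc W g a (x + a) := by
    filter_upwards [hshift.eventually hstar, eventually_ge_atTop 2] with x hx hx2
    rw [add_sub_cancel_right] at hx
    have hG := hneg x (by linarith)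
    have hT : 0 < Theta lam φ W x := one_pos.trans_le (one_le_Theta hW hlam φ (by linarith))
    have hR := hZT x hx2
    have hE : lam * Real.exp (-φ * x) * (Zfun q lam W x / Theta lam φ W x) ≤ lam + q := by
      rw [← mul_div_assoc, div_le_iff₀ hT]
      exact exp_mul_Zfun_le_Theta hWm hW hq hlam hφ (by linarith)
    generalize Gam lam φ Kp Kc W g a (x + a) = G at *
    generalize gam Kp Kc W g a (x + a) = γ at *
    rw [mul_div_assoc] at hx
    generalize Zfun q lam W x / Theta lam φ W x = R at *
    have hRpos : 0 < R := lt_of_lt_of_le (by positivity) hR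
    have hx' : φ * -G * R < (lam + q - lam * Real.exp (-φ * x) * R) * γ := by
      have e : (φ / q * G - lam / q * Real.exp (-φ * x) * γ) * R + (lam + q) / q * γ =
          ((lam + q - lam * Real.exp (-φ * x) * R) * γ - φ * -G * R) / q := by
        field_simp
        ring
      rw [e, div_pos_iff_of_pos_right hq] at hx
      linarith
    have hG' : 0 ≤ -G := by linarith
    have h0 : 0 ≤ φ * -G * R := by positivity
    have hγ : 0 < γ := pos_of_mul_pos_right (h0.trans_lt hx') (by linarith)
    refine ⟨hγ, ?_⟩
    have h1 : (lam + q - lam * Real.exp (-φ * x) * R) * γ ≤ (lam + q) * γ := by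
      refine mul_le_mul_of_nonneg_right ?_ hγ.le
      have : 0 ≤ lam * Real.exp (-φ * x) * R := by positivity
      linarith
    have h2 : φ * -G * (c₀ * Real.exp (φ * x)) ≤ φ * -G * R := by gcongr
    have h3 : c * Real.exp (φ * x) * -G = φ * -G * (c₀ * Real.exp (φ * x)) / (lam + q) := by
      rw [hc]; ring
    rw [h3, div_le_iff₀ (by positivity)]
    linarith
  obtain ⟨X, hX⟩ := eventually_atTop.1 (key.and (eventually_ge_atTop 2))
  have hX0 : 0 ≤ X := by linarith [(hX X le_rfl).2]
  have hsub : ∀ x₁ x₂ : ℝ, 0 ≤ x₁ → 0 ≤ x₂ → _ := fun x₁ x₂ h1 h2 =>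
    Gam_sub_Gam hW0 hg hO hΦ hWm hW hV lam Kp Kc a hφ (x₁ := x₁) (x₂ := x₂) h1 h2
  have hintg : ∀ x₁ x₂ : ℝ, 0 ≤ x₁ → 0 ≤ x₂ → _ := fun x₁ x₂ h1 h2 =>
    intervalIntegrable_exp_mul_gam hW0 hg hO hΦ hWm hW hV φ Kp Kc a (x₁ := x₁) (x₂ := x₂) h1 h2
  have hX1 : (0 : ℝ) ≤ X + 1 := by linarith
  have hδ : Gam lam φ Kp Kc W g a (X + 1 + a) < 0 := by
    have h1 := hsub X (X + 1) hX0 hX1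
    have h2 := intervalIntegral.intervalIntegral_pos_of_pos_on (hintg X (X + 1) hX0 hX1)
      (fun y hy => mul_pos (Real.exp_pos _) (hX y hy.1.le).1.1) (by linarith)
    have h3 := hneg X (by linarith [(hX X le_rfl).2])
    nlinarith
  set δ := -Gam lam φ Kp Kc W g a (X + 1 + a) with hδdef
  have hδpos : 0 < δ := by linarith
  have hGle : ∀ x, X + 1 ≤ x → Gam lam φ Kp Kc W g a (x + a) ≤ -δ := by
    intro x hx
    have h1 := hsub (X + 1) x hX1 (hX1.trans hx)
    have h2 : 0 ≤ ∫ y in (X + 1)..x, Real.exp (-φ * y) * gam Kp Kc W g a (y + a) :=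
      intervalIntegral.integral_nonneg hx fun y hy =>
        mul_nonneg (Real.exp_pos _).le (hX y (by linarith [hy.1])).1.1.le
    nlinarith
  have hγge : ∀ x, X + 1 ≤ x → c * δ * Real.exp (φ * x) ≤ gam Kp Kc W g a (x + a) := by
    intro x hx
    refine le_trans ?_ (hX x (by linarith)).1.2
    rw [mul_right_comm]
    gcongr
    linarith [hGle x hx]
  rcases hcase with ⟨l, hl⟩ | ⟨l, hl⟩
  · have h1 : Tendsto (fun x => gam Kp Kc W g a (x + a)) atTop (nhds (-l + Kp - Kc)) :=
      ((hl.comp hshift).neg.add_const Kp).sub_const Kc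
    refine not_tendsto_nhds_of_tendsto_atTop ?_ _ h1
    refine tendsto_atTop_mono' _ ?_ ((Real.tendsto_exp_atTop.comp
      (tendsto_id.const_mul_atTop hφ)).const_mul_atTop (mul_pos hcpos hδpos))
    filter_upwards [eventually_ge_atTop (X + 1)] with x hx using hγge x hx
  · refine not_tendsto_nhds_of_tendsto_atBot ?_ _ (hl.comp hshift)
    have hlin : Tendsto (fun x => -(lam * (c * δ)) * (x + -(X + 1))) atTop atBot :=
      (tendsto_atTop_add_const_right _ _ tendsto_id).const_mul_atTop_of_neg
        (neg_lt_zero.2 (by positivity))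
    refine tendsto_atBot_mono' _ ?_ hlin
    filter_upwards [eventually_ge_atTop (X + 1)] with x hx
    have h1 := hsub (X + 1) x hX1 (hX1.trans hx)
    have h2 := intervalIntegral.integral_mono_on hx (intervalIntegrable_const (c := c * δ))
      (hintg (X + 1) x hX1 (hX1.trans hx)) fun y hy => by
        have h3 := mul_le_mul_of_nonneg_left (hγge y hy.1) (Real.exp_pos (-φ * y)).le
        have e : Real.exp (-φ * y) * Real.exp (φ * y) = 1 := by
          rw [← Real.exp_add, Real.exp_eq_one_iff]; ring
        rwa [mul_left_comm, e, mul_one] at h3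
    rw [intervalIntegral.integral_const, smul_eq_mul] at h2
    have h4 := mul_le_mul_of_nonneg_left h2 hlam.le
    simp only [Function.comp]
    linarith

/-- Lemma 5.7 (the upcrossing lemma) of the paper. -/
theorem upcrossing_lemma
    (q lam Phiq Phiql : ℝ) (hq : 0 < q) (hlam : 0 < lam)
    (hPhiq : 0 < Phiq) (hPhi : Phiq < Phiql)
    (W : ℝ → ℝ)
    (hW0 : ∀ x < (0:ℝ), W x = 0)
    (hWnn : ∀ x ≥ (0:ℝ), 0 ≤ W x)
    (hWcont : ContinuousOn W (Set.Ici 0))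
    (hWmono : StrictMonoOn W (Set.Ici 0))
    (hWC1 : ContDiffOn ℝ 1 W (Set.Ioi 0))
    (hWratio_mono : ∀ a y : ℝ, a < y →
      MonotoneOn (fun b => W (b - y) / W (b - a)) (Set.Ioi y))
    (hWratio_lim : ∀ a y : ℝ, a < y →
      Filter.Tendsto (fun b => W (b - y) / W (b - a)) Filter.atTop
        (nhds (Real.exp (-Phiql * (y - a)))))
    (hWasymp : ∃ L : ℝ, 0 < L ∧
      Filter.Tendsto (fun x => Real.exp (-Phiql * x) * W x) Filter.atTop (nhds L))
    (f f' : ℝ → ℝ)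
    (hf_conv : ConvexOn ℝ Set.univ f)
    (hf_deriv : ∀ x : ℝ, HasDerivWithinAt f (f' x) (Set.Ici x) x)
    (hf_pw : ∃ E : Set ℝ, E.Countable ∧ ∀ x ∉ E, ContinuousAt f' x)
    (hf_growth : ∃ C M : ℝ, ∃ N : ℕ, 0 < C ∧ 0 < M ∧
      ∀ x : ℝ, M < |x| → |f x| ≤ C * |x| ^ N)
    (Kc Kp : ℝ) (hK : Kp < Kc)
    (g : ℝ → ℝ) (hg : ∀ x : ℝ, g x = f' x + q * Kc + lam * (Kc - Kp))
    (habar_ne : {a : ℝ | 0 ≤ g a}.Nonempty)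
    (habar_bdd : BddBelow {a : ℝ | 0 ≤ g a})
    (habb_ne : {a : ℝ | 0 < f' a + q * Kp}.Nonempty)
    (habb_bdd : BddBelow {a : ℝ | 0 < f' a + q * Kp})
    (a1 a2 : ℝ)
    (ha1 : a1 = sInf {a : ℝ | 0 ≤ Gam1 lam Phiq Kp Kc g a})
    (ha2 : a2 = sInf {a : ℝ | 0 ≤ Gam2 Phiql g a})
    (ha21 : a2 < a1)
    (hstar :
      Filter.Tendsto (fun b =>
          (Phiq / q * Gam lam Phiq Kp Kc W g a2 b
              - lam / q * Real.exp (-Phiq * (b - a2)) * gam Kp Kc W g a2 b)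
            * Zfun q lam W (b - a2) / Theta lam Phiq W (b - a2)
          + (lam + q) / q * gam Kp Kc W g a2 b) Filter.atTop Filter.atTop ∨
      ∃ L : ℝ, 0 < L ∧ Filter.Tendsto (fun b =>
          (Phiq / q * Gam lam Phiq Kp Kc W g a2 b
              - lam / q * Real.exp (-Phiq * (b - a2)) * gam Kp Kc W g a2 b)
            * Zfun q lam W (b - a2) / Theta lam Phiq W (b - a2)
          + (lam + q) / q * gam Kp Kc W g a2 b) Filter.atTop (nhds L))
    (hcase :
      (∃ L : ℝ, Filter.Tendsto (fun b => rho W g a2 b) Filter.atTop (nhds L)) ∨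
      (∃ L : ℝ, Filter.Tendsto (fun b => Gam lam Phiq Kp Kc W g a2 b)
        Filter.atTop (nhds L))) :
    0 < sSup ((fun b => Gam lam Phiq Kp Kc W g a2 b) '' Set.Ioi a2) ∧
    ∃ L : ℝ, 0 < L ∧
      Filter.Tendsto (fun a => sSup ((fun b => Gam lam Phiq Kp Kc W g a b) '' Set.Ioi a))
        (nhdsWithin a2 (Set.Iio a2)) (nhds L) := by
  have hWm : Monotone W := monotone_scale hW0 hWnn hWmono
  have hWnn' : ∀ x, 0 ≤ W x := fun x => (lt_or_ge x 0).elim (fun h => (hW0 x h).ge) (hWnn x)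
  have hW1 : 0 < W 1 :=
    (hWnn 0 le_rfl).trans_lt (hWmono Set.self_mem_Ici (by simp) one_pos)
  have hV := monotone_exp_mul_scale hW0 hWnn hWcont hWmono hWratio_mono hWratio_lim
  obtain ⟨L, hL, hLlim⟩ := hWasymp
  have hΦ : 0 < Phiql := hPhiq.trans hPhi
  have hf'm := monotone_of_hasDerivWithinAt_Ici hf_conv hf_deriv
  have hgm : Monotone g := fun x y hxy => by
    rw [hg, hg]
    linarith [hf'm hxy]
  obtain ⟨C, M, N, -, -, hgrow⟩ := hf_growth
  have hO : ∀ ε, 0 < ε → g =O[atTop] fun x => Real.exp (ε * x) := by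
    intro ε hε
    have h1 := isBigO_exp_rightDeriv hf_conv hf_deriv (isBigO_exp_of_poly_growth hgrow hε) hε
    have h2 : (fun _ : ℝ => q * Kc + lam * (Kc - Kp)) =O[atTop] fun x => Real.exp (ε * x) := by
      refine Asymptotics.IsBigO.of_bound ‖q * Kc + lam * (Kc - Kp)‖ ?_
      filter_upwards [eventually_ge_atTop 0] with x hx
      rw [Real.norm_eq_abs (Real.exp _), Real.abs_exp]
      exact le_mul_of_one_le_right (norm_nonneg _) (Real.one_le_exp (by positivity))
    refine (h1.add h2).congr_left fun x => ?_
    rw [hg, add_assoc]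
  obtain ⟨m, hm⟩ := habar_bdd
  have hgneg : g (m - 1) < 0 := not_le.1 fun h => (sub_one_lt m).not_ge (hm h)
  obtain ⟨a₀, ha₀⟩ := exists_Gam2_neg hgm hO hΦ hgneg
  have hGam2 : ∀ a < a2, Gam2 Phiql g a ≤ 0 := by
    intro a ha
    rw [ha2] at ha
    have hb : BddBelow {a : ℝ | 0 ≤ Gam2 Phiql g a} :=
      ⟨a₀, fun b hb => (not_le.1 fun h => (ha₀ b h).not_ge hb).le⟩
    exact (not_le.1 fun h => ha.not_ge (csInf_le hb h)).le
  set H : ℝ := ∫ y in Set.Ioi (0 : ℝ), Real.exp (-Phiq * y) * g (y + a2) with hH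
  have hmono : ∀ x, 0 ≤ x → Monotone fun a => Gam lam Phiq Kp Kc W g a (x + a) := fun x hx =>
    Gam_add_mono hW0 hgm hO hΦ hWm hWnn' hV hlam hPhiq Kp Kc hx
  have hlimG : ∀ x, 0 ≤ x → Tendsto (fun a => Gam lam Phiq Kp Kc W g a (x + a))
      (nhdsWithin a2 (Set.Iio a2)) (nhds (Gam lam Phiq Kp Kc W g a2 (x + a2))) := fun x hx =>
    tendsto_Gam_add hW0 hgm hO hΦ hWm hWnn' hV hPhiq lam Kp Kc a2 hx
  have hle2 : ∀ x, 0 ≤ x → Gam lam Phiq Kp Kc W g a2 (x + a2) ≤ H := by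
    intro x hx
    refine le_of_tendsto (hlimG x hx) ?_
    filter_upwards [self_mem_nhdsWithin] with a ha
    refine (Gam_add_le hW0 hgm hO hΦ hWm hWnn' hV habar_ne ⟨m, hm⟩ hlam hPhiq hK
      (hGam2 a ha) hx).trans ?_
    exact integral_mono (integrableOn_exp_mul_shift hgm hO hPhiq a)
      (integrableOn_exp_mul_shift hgm hO hPhiq a2) fun y =>
        mul_le_mul_of_nonneg_left (hgm (by linarith [Set.mem_Iio.1 ha])) (Real.exp_pos _).le
  have himage : ∀ a, (fun b => Gam lam Phiq Kp Kc W g a b) '' Set.Ioi a =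
      (fun x => Gam lam Phiq Kp Kc W g a (x + a)) '' Set.Ioi 0 := by
    intro a
    have : Set.Ioi a = (fun x => x + a) '' Set.Ioi 0 := by simp
    rw [this, Set.image_image]
  simp only [himage]
  set S : ℝ → ℝ := fun a => sSup ((fun x => Gam lam Phiq Kp Kc W g a (x + a)) '' Set.Ioi 0) with hS
  have hne : ∀ a, ((fun x => Gam lam Phiq Kp Kc W g a (x + a)) '' Set.Ioi 0).Nonempty := fun a =>
    Set.nonempty_Ioi.image _
  have hbdd : ∀ a ≤ a2, BddAbove ((fun x => Gam lam Phiq Kp Kc W g a (x + a)) '' Set.Ioi 0) := by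
    rintro a ha
    refine ⟨H, ?_⟩
    rintro _ ⟨x, hx, rfl⟩
    exact (hmono x (le_of_lt hx) ha).trans (hle2 x (le_of_lt hx))
  have hSmono : MonotoneOn S (Set.Iic a2) := by
    intro a _ b hb hab
    refine csSup_le (hne a) ?_
    rintro _ ⟨x, hx, rfl⟩
    exact (hmono x (le_of_lt hx) hab).trans (le_csSup (hbdd b hb) ⟨x, hx, rfl⟩)
  obtain ⟨x, hx, hxpos⟩ := exists_Gam_pos hW0 hgm hO hΦ hWm hWnn' hW1 hV hL
    (hV.ge_of_tendsto hLlim) hq hlam hPhiq hPhi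
    (hstar.elim (fun h => h.eventually_gt_atTop 0) fun ⟨_, hl, h⟩ => h.eventually_const_lt hl) hcase
  refine ⟨hxpos.trans_le (le_csSup (hbdd a2 le_rfl) ⟨x, hx, rfl⟩), sSup (S '' Set.Iio a2), ?_, ?_⟩
  · obtain ⟨a, hapos, ha⟩ :=
      (((hlimG x hx.le).eventually_const_lt hxpos).and self_mem_nhdsWithin).exists
    have h1 : Gam lam Phiq Kp Kc W g a (x + a) ≤ S a :=
      le_csSup (hbdd a (le_of_lt ha)) ⟨x, hx, rfl⟩
    have h2 : S a ≤ sSup (S '' Set.Iio a2) := by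
      refine le_csSup ⟨S a2, ?_⟩ ⟨a, ha, rfl⟩
      rintro _ ⟨b, hb, rfl⟩
      exact hSmono (Set.Iio_subset_Iic_self hb) Set.self_mem_Iic (le_of_lt hb)
    exact hapos.trans_le (h1.trans h2)
  · refine (hSmono.mono Set.Iio_subset_Iic_self).tendsto_nhdsLT ?_
    refine ⟨S a2, ?_⟩
    rintro _ ⟨b, hb, rfl⟩
    exact hSmono (Set.Iio_subset_Iic_self hb) Set.self_mem_Iic (le_of_lt hb)
end
end
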